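/- arXiv:0805.4029 — 5 statements merged into one kernel-verified Lean document; each statement's English description precedes it below -/
import Mathlib

section
/- Let Π_{i∈1..n} Sᵢ be a program whose set of channels is 𝒞. Then Π_{i∈1..n} Sᵢ ~ (Π_{c∈𝒞} ⊙_c | Π_{i∈1..n} Ŝᵢ); that is, every program is related by the bisimulation ~ to its compiled state. -/
/-
Formalization of the distributed event-synchronization protocol of
"Event Synchronization by Lightweight Message Passing" (Chaudhuri).

Source language: programs are multisets (parallel compositions, up to
structural congruence) of statements, each either an action or a
`select` over a list of actions.

Abstract machine: states are multisets of sub-states (parallel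
composition up to structural congruence; name restriction is handled
by freshness side conditions on transitions).
-/

namespace CML

/-- Point names. -/
abbrev Point := ℕ
/-- Channel names. -/
abbrev Chan := ℕ

/-- Actions: input `c` or output `c̄` on a channel `c`. -/
inductive Act : Type
  | inp (c : Chan)
  | out (c : Chan)
  deriving DecidableEq

/-- The channel of an action. -/
def Act.chan : Act → Chan
  | .inp c => c
  | .out c => c

/-- A synchronizer: a partial function from points to actions, represented
as a (functional) multiset of bindings `p ↦ α`. -/
abbrev Sync := { m : Multiset (Point × Act) // (m.map Prod.fst).Nodup }

/-- The domain of a synchronizer. -/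
def Sync.dom (s : Sync) : Multiset Point := s.1.map Prod.fst

/-- The multiset of actions of a synchronizer. -/
def Sync.acts (s : Sync) : Multiset Act := s.1.map Prod.snd

/-- `s.maps p α` iff `s(p) = α`. -/
def Sync.maps (s : Sync) (p : Point) (α : Act) : Prop := (p, α) ∈ s.1

/-- `c` occurs in the actions of `s`. -/
def Sync.hasChan (s : Sync) (c : Chan) : Prop := ∃ e ∈ s.1, Act.chan e.2 = c

/-- Sub-states of points, channels and synchronizers. -/
inductive SubState : Type
  | unmatched (p : Point) (α : Act)              -- p ↦ α
  | candidate (p : Point)                        -- Candidate_p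
  | released (α : Act)                           -- a released (bare) action α
  | free (c : Chan)                              -- ⊙_c
  | matched (c : Chan) (p q : Point)             -- Match_c(p,q)
  | opened (s : Sync)                            -- □_s
  | closed (s : Sync)                            -- ⊠_s
  | selected (s : Sync) (p : Point)              -- Select_s(p)
  | reject (p : Point)                           -- Reject(p)
  | done (s : Sync) (p : Point)                  -- Done_s(p)
  | retry (s : Sync)                             -- Retry_s
  deriving DecidableEq

/-- A machine state: a parallel composition of sub-states. -/
abbrev State := Multiset SubState

/-- `p` occurs as a point (name) in a sub-state. -/
def pointIn (p : Point) : SubState → Prop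
  | .unmatched q _ => p = q
  | .candidate q => p = q
  | .released _ => False
  | .free _ => False
  | .matched _ q r => p = q ∨ p = r
  | .opened s => p ∈ s.dom
  | .closed s => p ∈ s.dom
  | .selected s q => p = q ∨ p ∈ s.dom
  | .reject q => p = q
  | .done s q => p = q ∨ p ∈ s.dom
  | .retry s => p ∈ s.dom

/-- `c` occurs as a channel in a sub-state. -/
def chanIn (c : Chan) : SubState → Prop
  | .unmatched _ α => α.chan = c
  | .candidate _ => False
  | .released α => α.chan = c
  | .free d => d = c
  | .matched d _ _ => d = c
  | .opened s => s.hasChan c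
  | .closed s => s.hasChan c
  | .selected s _ => s.hasChan c
  | .reject _ => False
  | .done s _ => s.hasChan c
  | .retry s => s.hasChan c

/-- The synchronizer (if any) of a sub-state. -/
def syncOf : SubState → Option Sync
  | .opened s => some s
  | .closed s => some s
  | .selected s _ => some s
  | .done s _ => some s
  | .retry s => some s
  | _ => none

/-- The set of points `P` of a state. -/
def State.HasPoint (σ : State) (p : Point) : Prop := ∃ ς ∈ σ, pointIn p ς

/-- The set of channels `𝒞` of a state. -/
def State.HasChan (σ : State) (c : Chan) : Prop := ∃ ς ∈ σ, chanIn c ς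

/-- The set of synchronizers `𝒮` of a state. -/
def State.HasSync (σ : State) (s : Sync) : Prop := ∃ ς ∈ σ, syncOf ς = some s

/-- The machine transitions (structural rules are absorbed by the
multiset representation). -/
inductive Step : State → State → Prop
  /-- (I) `p↦c | q↦c̄ | ⊙_c → Candidate_p | Candidate_q | Match_c(p,q)` -/
  | rI (p q : Point) (c : Chan) (rest : State) :
      Step (.unmatched p (.inp c) ::ₘ .unmatched q (.out c) ::ₘ .free c ::ₘ rest)
           (.candidate p ::ₘ .candidate q ::ₘ .matched c p q ::ₘ rest)
  /-- (II.i) `Candidate_p | □_s → ⊠_s | Select_s(p)` if `p ∈ dom(s)` -/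
  | rIIi (p : Point) (s : Sync) (rest : State) (h : p ∈ s.dom) :
      Step (.candidate p ::ₘ .opened s ::ₘ rest)
           (.closed s ::ₘ .selected s p ::ₘ rest)
  /-- (II.ii) `Candidate_p | ⊠_s → ⊠_s | Reject(p)` if `p ∈ dom(s)` -/
  | rIIii (p : Point) (s : Sync) (rest : State) (h : p ∈ s.dom) :
      Step (.candidate p ::ₘ .closed s ::ₘ rest)
           (.closed s ::ₘ .reject p ::ₘ rest)
  /-- (III.i) -/
  | rIIIi (s s' : Sync) (p q : Point) (c : Chan) (rest : State) :
      Step (.selected s p ::ₘ .selected s' q ::ₘ .matched c p q ::ₘ rest)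
           (.done s p ::ₘ .done s' q ::ₘ .free c ::ₘ rest)
  /-- (III.ii) -/
  | rIIIii (s : Sync) (p q : Point) (c : Chan) (rest : State) :
      Step (.selected s p ::ₘ .reject q ::ₘ .matched c p q ::ₘ rest)
           (.retry s ::ₘ .free c ::ₘ rest)
  /-- (III.iii) -/
  | rIIIiii (s' : Sync) (p q : Point) (c : Chan) (rest : State) :
      Step (.reject p ::ₘ .selected s' q ::ₘ .matched c p q ::ₘ rest)
           (.retry s' ::ₘ .free c ::ₘ rest)
  /-- (III.iv) -/
  | rIIIiv (p q : Point) (c : Chan) (rest : State) :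
      Step (.reject p ::ₘ .reject q ::ₘ .matched c p q ::ₘ rest)
           (.free c ::ₘ rest)
  /-- (IV.i) `Done_s(p) → α` if `s(p) = α` -/
  | rIVi (s : Sync) (p : Point) (α : Act) (rest : State) (h : s.maps p α) :
      Step (.done s p ::ₘ rest) (.released α ::ₘ rest)
  /-- (IV.ii) `Retry_s → (νp⃗)(□_s | s)` where the synchronizer reboots
  with fresh names for the points in its domain (same actions). -/
  | rIVii (s s' : Sync) (rest : State)
      (hacts : s'.acts = s.acts)
      (hfresh : ∀ p ∈ s'.dom, ¬ State.HasPoint rest p) :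
      Step (.retry s ::ₘ rest)
           (.opened s' ::ₘ (s'.1.map (fun e => SubState.unmatched e.1 e.2) + rest))

/-- Statements of the source language. -/
inductive Stmt : Type
  | act (α : Act)
  | select (αs : List Act)
  deriving DecidableEq

/-- A program: a parallel composition of statements. -/
abbrev Program := Multiset Stmt

/-- Program reduction:
`select(α⃗) | select(β⃗) → c | c̄` whenever `c ∈ α⃗` and `c̄ ∈ β⃗`. -/
inductive PStep : Program → Program → Prop
  | comm (αs βs : List Act) (c : Chan) (rest : Program)
      (h1 : Act.inp c ∈ αs) (h2 : Act.out c ∈ βs) :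
      PStep (.select αs ::ₘ .select βs ::ₘ rest)
            (.act (.inp c) ::ₘ .act (.out c) ::ₘ rest)

/-- Denotation of a program: the multiset of its (bare) actions. -/
def Prog.den (P : Program) : Multiset Act :=
  P.bind fun S => match S with
    | .act α => {α}
    | .select _ => 0

/-- Denotation of a state: the multiset of its released actions. -/
def State.den (σ : State) : Multiset Act :=
  σ.bind fun ς => match ς with
    | .released α => {α}
    | _ => 0

/-- The channels of a statement. -/
def Stmt.chans : Stmt → Finset Chan
  | .act α => {α.chan}
  | .select αs => (αs.map Act.chan).toFinset

/-- The set of channels `𝒞` of a program. -/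
def Prog.chans (P : Program) : Finset Chan := (P.map Stmt.chans).sup

/-- Compilation of a single statement `S` to `Ŝ`, given the synchronizer
used for it (a dummy empty synchronizer for bare actions):
`Ŝ = α` if `S = α`, and `Ŝ = (νp⃗)(□_s | s)` if `S = select(α₁,…,α_k)`
with `s = Π_j (p_j ↦ α_j)`. -/
def compUnit : Stmt → Sync → Multiset SubState → Prop
  | .act α, s, m => s.1 = 0 ∧ m = {SubState.released α}
  | .select αs, s, m => s.acts = ↑αs ∧
      m = SubState.opened s ::ₘ s.1.map (fun e => SubState.unmatched e.1 e.2)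

/-- `Compiles P σ`: `σ` is the compiled state `Π_{c∈𝒞} ⊙_c | Π_i Ŝᵢ` of
the program `P = Π_i Sᵢ`, for some choice of fresh points (synchronizers
of distinct statements have pairwise disjoint domains). -/
def Compiles (P : Program) (σ : State) : Prop :=
  ∃ l : List (Stmt × Sync × Multiset SubState),
    (↑(l.map fun e => e.1) : Multiset Stmt) = P ∧
    (∀ e ∈ l, compUnit e.1 e.2.1 e.2.2) ∧
    List.Pairwise (fun e e' => ∀ p : Point, p ∈ e.2.1.dom → p ∈ e'.2.1.dom → False) l ∧
    σ = Multiset.map SubState.free (Prog.chans P).val + (l.map fun e => e.2.2).sum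

/-- Is `ς` of the form `Match_c(_,_)`? -/
def isMatchOn (c : Chan) : SubState → Bool
  | .matched d _ _ => c = d
  | _ => false

/-- Number of occurrences of `Match_c(_,_)` in `σ`. -/
def countMatch (c : Chan) (σ : State) : ℕ :=
  (σ.filter fun ς => isMatchOn c ς = true).card

/-- Is `ς` one of `Select_s(_)`, `Done_s(_)`, `Retry_s`? -/
def isCommitTok (s : Sync) : SubState → Bool
  | .selected s' _ => decide (s = s')
  | .done s' _ => decide (s = s')
  | .retry s' => decide (s = s')
  | _ => false

/-- Number of occurrences of `Select_s(_)`, `Done_s(_)`, `Retry_s` in `σ`. -/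
def countCommit (s : Sync) (σ : State) : ℕ :=
  (σ.filter fun ς => isCommitTok s ς = true).card

/-- The invariants (1)–(4): `⊢σ`. -/
def Inv (σ : State) : Prop :=
  -- (1)
  (∀ p : Point, σ.HasPoint p →
    (∃! s : Sync, σ.HasSync s ∧ p ∈ s.dom) ∧
    (∀ s : Sync, σ.HasSync s → ∀ α : Act, s.maps p α →
      (σ.count (.unmatched p α) + σ.count (.candidate p) + σ.count (.selected s p)
        + σ.count (.reject p) + σ.count (.done s p) + σ.count (.retry s) ≤ 1) ∧
      σ.count (.opened s) + σ.count (.closed s) = 1))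
  -- (2)
  ∧ (∀ c : Chan, σ.HasChan c → σ.count (.free c) + countMatch c σ = 1)
  -- (3)
  ∧ (∀ (p : Point) (s : Sync), σ.HasSync s → p ∈ s.dom →
      ((SubState.selected s p ∈ σ ∨ SubState.reject p ∈ σ ∨
        SubState.done s p ∈ σ ∨ SubState.retry s ∈ σ) →
        SubState.closed s ∈ σ))
  ∧ (∀ s : Sync, σ.HasSync s → SubState.closed s ∈ σ → countCommit s σ ≤ 1)
  -- (4)
  ∧ (∀ (c : Chan) (p q : Point), SubState.matched c p q ∈ σ ↔
      ∃ s s' : Sync, σ.HasSync s ∧ σ.HasSync s' ∧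
        s.maps p (.inp c) ∧ s'.maps q (.out c) ∧
        (SubState.candidate p ∈ σ ∨ SubState.selected s p ∈ σ ∨ SubState.reject p ∈ σ) ∧
        (SubState.candidate q ∈ σ ∨ SubState.selected s' q ∈ σ ∨ SubState.reject q ∈ σ))

/-- A post-fixed point of the (Correspondence)/(Safety)/(Progress)
functional defining `~`. -/
def IsSim (R : Program → State → Prop) : Prop :=
  ∀ P σ, R P σ →
    -- (Correspondence)
    (∃ σ', Relation.ReflTransGen Step σ σ' ∧ Prog.den P = State.den σ') ∧
    -- (Safety)
    (∀ σ', Step σ σ' → ∃ P', Relation.ReflTransGen PStep P P' ∧ R P' σ') ∧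
    -- (Progress)
    ((∃ Q, PStep P Q) →
      ∃ σ' P', Relation.TransGen Step σ σ' ∧ PStep P P' ∧ R P' σ')

/-- `P ~ σ`: the largest relation `R` such that `R P σ` implies
(Correspondence), (Safety) and (Progress). -/
def Bisim (P : Program) (σ : State) : Prop := ∃ R, IsSim R ∧ R P σ

def wN (p : Point) : SubState → ℕ
  | .opened s => s.dom.count p
  | .closed s => s.dom.count p
  | _ => 0

def wM (p : Point) : SubState → ℕ
  | .matched _ q r => (if q = p then 1 else 0) + (if r = p then 1 else 0)
  | _ => 0

def wB (p : Point) : SubState → ℕ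
  | .candidate q => if q = p then 1 else 0
  | .reject q => if q = p then 1 else 0
  | .selected _ q => if q = p then 1 else 0
  | _ => 0

def wC (c : Chan) : SubState → ℕ
  | .free d => if d = c then 1 else 0
  | .matched d _ _ => if d = c then 1 else 0
  | _ => 0

def wT : SubState → ℕ
  | .candidate _ => 1
  | .matched _ _ _ => 2
  | .retry _ => 1
  | _ => 0

def wA : SubState → Multiset (Act ⊕ Multiset Act)
  | .released α => {Sum.inl α}
  | .done s p => (s.1.filter (fun e => e.1 = p)).map (fun e => Sum.inl e.2)
  | .opened s => {Sum.inr s.acts}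
  | .selected s _ => {Sum.inr s.acts}
  | .retry s => {Sum.inr s.acts}
  | _ => 0

def absS : Stmt → Act ⊕ Multiset Act
  | .act α => Sum.inl α
  | .select αs => Sum.inr (αs : Multiset Act)

def Bd (σ : State) (p : Point) (α : Act) : Prop :=
  ∃ s : Sync, (SubState.opened s ∈ σ ∨ SubState.closed s ∈ σ) ∧ (p, α) ∈ s.1

structure Good (P : Program) (σ : State) : Prop where
  hA : P.map absS = (σ.map wA).sum
  hN : ∀ p, (σ.map (wN p)).sum ≤ 1
  hMB : ∀ p, (σ.map (wM p)).sum = (σ.map (wB p)).sum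
  hU : ∀ p α, SubState.unmatched p α ∈ σ → Bd σ p α
  hMt : ∀ c p q, SubState.matched c p q ∈ σ → Bd σ p (.inp c) ∧ Bd σ q (.out c)
  hS : ∀ s p, SubState.selected s p ∈ σ → SubState.closed s ∈ σ ∧ p ∈ s.dom
  hD : ∀ s p, SubState.done s p ∈ σ → p ∈ s.dom
  hO : ∀ s, SubState.opened s ∈ σ → ∀ e ∈ s.1,
    SubState.unmatched e.1 e.2 ∈ σ ∨ SubState.candidate e.1 ∈ σ
  hC : ∀ αs, Stmt.select αs ∈ P → ∀ α ∈ αs, 1 ≤ (σ.map (wC α.chan)).sum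

theorem mem_dom {s : Sync} {p : Point} : p ∈ s.dom ↔ ∃ α, (p, α) ∈ s.1 := by
  simp [Sync.dom]

theorem dom_count {s : Sync} {p : Point} (h : p ∈ s.dom) : s.dom.count p = 1 :=
  Multiset.count_eq_one_of_mem s.2 h

theorem sync_fun {s : Sync} {p : Point} {α β : Act} (h : (p, α) ∈ s.1) (h' : (p, β) ∈ s.1) :
    α = β := by
  have := Multiset.inj_on_of_nodup_map s.2 _ h _ h' rfl
  simpa using this

theorem wA_done {s : Sync} {p : Point} {α : Act} (h : (p, α) ∈ s.1) :
    wA (.done s p) = {Sum.inl α} := by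
  have hn : s.1.Nodup := Multiset.Nodup.of_map _ s.2
  have : s.1.filter (fun e => e.1 = p) = {(p, α)} := by
    apply (Multiset.Nodup.ext (hn.filter _) (Multiset.nodup_singleton _)).2
    rintro ⟨q, β⟩
    simp only [Multiset.mem_filter, Multiset.mem_singleton, Prod.mk.injEq]
    constructor
    · rintro ⟨h1, rfl⟩
      exact ⟨rfl, sync_fun h1 h⟩
    · rintro ⟨rfl, rfl⟩
      exact ⟨h, rfl⟩
  simp [wA, this]

theorem sum_pos_of_mem {f : SubState → ℕ} {σ : State} {x : SubState} (h : x ∈ σ)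
    (hx : 1 ≤ f x) : 1 ≤ (σ.map f).sum := by
  obtain ⟨t, rfl⟩ := Multiset.exists_cons_of_mem h
  simp; omega

theorem exists_of_sum_pos {f : SubState → ℕ} {σ : State} (h : 1 ≤ (σ.map f).sum) :
    ∃ x ∈ σ, 1 ≤ f x := by
  by_contra! hc
  have : (σ.map f).sum = 0 := by
    apply Multiset.sum_eq_zero
    intro y hy
    obtain ⟨x, hx, rfl⟩ := Multiset.mem_map.1 hy
    have := hc x hx
    omega
  omega

/-- two binders of the same point coincide -/
theorem binder_unique {σ : State} {p : Point} (hN : (σ.map (wN p)).sum ≤ 1) {x y : SubState}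
    (hx : x ∈ σ) (hy : y ∈ σ) (h1 : 1 ≤ wN p x) (h2 : 1 ≤ wN p y) : x = y := by
  by_contra hne
  obtain ⟨t, rfl⟩ := Multiset.exists_cons_of_mem hx
  have hy' : y ∈ t := by
    rcases Multiset.mem_cons.1 hy with h | h
    · exact absurd h.symm hne
    · exact h
  obtain ⟨u, rfl⟩ := Multiset.exists_cons_of_mem hy'
  simp at hN
  omega

theorem wN_opened {s : Sync} {p : Point} (h : p ∈ s.dom) : wN p (.opened s) = 1 := dom_count h
theorem wN_closed {s : Sync} {p : Point} (h : p ∈ s.dom) : wN p (.closed s) = 1 := dom_count h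

theorem bd_sync {σ : State} {p : Point} {α : Act} (hN : (σ.map (wN p)).sum ≤ 1) (hb : Bd σ p α)
    {s : Sync} (hs : SubState.closed s ∈ σ) (hp : p ∈ s.dom) : (p, α) ∈ s.1 := by
  obtain ⟨s', h, hm⟩ := hb
  have hp' : p ∈ s'.dom := mem_dom.2 ⟨_, hm⟩
  rcases h with h | h
  · have := binder_unique hN hs h (wN_closed hp).ge (wN_opened hp').ge
    simp at this
  · have := binder_unique hN hs h (wN_closed hp).ge (wN_closed hp').ge
    simp at this
    subst this
    exact hm

theorem bd_fun {σ : State} {p : Point} {α β : Act} (hN : (σ.map (wN p)).sum ≤ 1) (hb : Bd σ p α)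
    (hb' : Bd σ p β) : α = β := by
  obtain ⟨s, h, hm⟩ := hb
  obtain ⟨s', h', hm'⟩ := hb'
  have hp : p ∈ s.dom := mem_dom.2 ⟨_, hm⟩
  have hp' : p ∈ s'.dom := mem_dom.2 ⟨_, hm'⟩
  have : s = s' := by
    rcases h with h | h <;> rcases h' with h' | h'
    · simpa using binder_unique hN h h' (wN_opened hp).ge (wN_opened hp').ge
    · simpa using binder_unique hN h h' (wN_opened hp).ge (wN_closed hp').ge
    · simpa using binder_unique hN h h' (wN_closed hp).ge (wN_opened hp').ge
    · simpa using binder_unique hN h h' (wN_closed hp).ge (wN_closed hp').ge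
  subst this
  exact sync_fun hm hm'

theorem Bd.mono {σ τ : State} (h : ∀ s : Sync, (SubState.opened s ∈ σ ∨ SubState.closed s ∈ σ) →
    (SubState.opened s ∈ τ ∨ SubState.closed s ∈ τ)) {p : Point} {α : Act} (hb : Bd σ p α) :
    Bd τ p α := by
  obtain ⟨s, h1, h2⟩ := hb
  exact ⟨s, h s h1, h2⟩

theorem good_I {P : Program} {p q : Point} {c : Chan} {rest : State}
    (h : Good P (.unmatched p (.inp c) ::ₘ .unmatched q (.out c) ::ₘ .free c ::ₘ rest)) :
    Good P (.candidate p ::ₘ .candidate q ::ₘ .matched c p q ::ₘ rest) := by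
  obtain ⟨hA, hN, hMB, hU, hMt, hS, hD, hO, hC⟩ := h
  have hm : ∀ {p : Point} {α : Act},
      Bd (.unmatched p (.inp c) ::ₘ .unmatched q (.out c) ::ₘ .free c ::ₘ rest) p α → True :=
    fun _ => trivial
  have hb : ∀ {p' : Point} {α : Act},
      Bd (.unmatched p (.inp c) ::ₘ .unmatched q (.out c) ::ₘ .free c ::ₘ rest) p' α →
      Bd (.candidate p ::ₘ .candidate q ::ₘ .matched c p q ::ₘ rest) p' α :=
    fun h => h.mono (by simp)
  refine ⟨?_, ?_, ?_, ?_, ?_, ?_, ?_, ?_, ?_⟩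
  · simpa [wA] using hA
  · simpa [wN] using hN
  · intro r
    have := hMB r
    simp [wM, wB] at this ⊢
    omega
  · intro r α hr
    exact hb (hU r α (by simp at hr ⊢; tauto))
  · intro d r t hr
    simp at hr
    rcases hr with ⟨rfl, rfl, rfl⟩ | hr
    · exact ⟨hb (hU _ _ (by simp)), hb (hU _ _ (by simp))⟩
    · have := hMt d r t (by simp [hr])
      exact ⟨hb this.1, hb this.2⟩
  · intro s r hr
    have := hS s r (by simpa using hr)
    simpa using this
  · intro s r hr
    exact hD s r (by simpa using hr)
  · intro s hs e he
    have := hO s (by simpa using hs) e he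
    simp at this ⊢
    tauto
  · intro αs h1 α h2
    have := hC αs h1 α h2
    simp [wC] at this ⊢
    omega

theorem good_IIi {P : Program} {p : Point} {s : Sync} {rest : State} (hp : p ∈ s.dom)
    (h : Good P (.candidate p ::ₘ .opened s ::ₘ rest)) :
    Good P (.closed s ::ₘ .selected s p ::ₘ rest) := by
  obtain ⟨hA, hN, hMB, hU, hMt, hS, hD, hO, hC⟩ := h
  have hb : ∀ {p' : Point} {α : Act},
      Bd (.candidate p ::ₘ .opened s ::ₘ rest) p' α →
      Bd (.closed s ::ₘ .selected s p ::ₘ rest) p' α :=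
    fun h => h.mono (by simp; tauto)
  refine ⟨?_, ?_, ?_, ?_, ?_, ?_, ?_, ?_, ?_⟩
  · simpa [wA] using hA
  · simpa [wN] using hN
  · intro r
    have := hMB r
    simp [wM, wB] at this ⊢
    omega
  · intro r α hr
    exact hb (hU r α (by simpa using hr))
  · intro d r t hr
    have := hMt d r t (by simpa using hr)
    exact ⟨hb this.1, hb this.2⟩
  · intro s' r hr
    simp at hr
    rcases hr with ⟨rfl, rfl⟩ | hr
    · simp [hp]
    · have := hS s' r (by simp [hr])
      simp at this ⊢
      tauto
  · intro s r hr
    exact hD s r (by simpa using hr)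
  · intro s' hs e he
    simp at hs
    have := hO s' (by simp [hs]) e he
    simp at this ⊢
    rcases this with h | rfl | h
    · exact Or.inl h
    · exfalso
      have h1 := hN e.1
      have h2 := sum_pos_of_mem (f := wN e.1) hs
        (wN_opened (mem_dom.2 ⟨_, he⟩)).ge
      have := wN_opened hp
      simp at h1
      omega
    · exact Or.inr h
  · intro αs h1 α h2
    have := hC αs h1 α h2
    simp [wC] at this ⊢
    omega

theorem good_IIii {P : Program} {p : Point} {s : Sync} {rest : State} (hp : p ∈ s.dom)
    (h : Good P (.candidate p ::ₘ .closed s ::ₘ rest)) :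
    Good P (.closed s ::ₘ .reject p ::ₘ rest) := by
  obtain ⟨hA, hN, hMB, hU, hMt, hS, hD, hO, hC⟩ := h
  have hb : ∀ {p' : Point} {α : Act},
      Bd (.candidate p ::ₘ .closed s ::ₘ rest) p' α →
      Bd (.closed s ::ₘ .reject p ::ₘ rest) p' α :=
    fun h => h.mono (by simp)
  refine ⟨?_, ?_, ?_, ?_, ?_, ?_, ?_, ?_, ?_⟩
  · simpa [wA] using hA
  · simpa [wN] using hN
  · intro r
    have := hMB r
    simp [wM, wB] at this ⊢
    omega
  · intro r α hr
    exact hb (hU r α (by simpa using hr))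
  · intro d r t hr
    have := hMt d r t (by simpa using hr)
    exact ⟨hb this.1, hb this.2⟩
  · intro s' r hr
    have := hS s' r (by simpa using hr)
    simpa using this
  · intro s r hr
    exact hD s r (by simpa using hr)
  · intro s' hs e he
    simp at hs
    have := hO s' (by simp [hs]) e he
    simp at this ⊢
    rcases this with h | rfl | h
    · exact Or.inl h
    · exfalso
      have h1 := hN e.1
      have h2 := sum_pos_of_mem (f := wN e.1) hs
        (wN_opened (mem_dom.2 ⟨_, he⟩)).ge
      have := wN_closed hp
      simp at h1
      omega
    · exact Or.inr h
  · intro αs h1 α h2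
    have := hC αs h1 α h2
    simp [wC] at this ⊢
    omega

theorem good_IIIi {P : Program} {s s' : Sync} {p q : Point} {c : Chan} {rest : State}
    (h : Good P (.selected s p ::ₘ .selected s' q ::ₘ .matched c p q ::ₘ rest)) :
    ∃ P', PStep P P' ∧ Good P' (.done s p ::ₘ .done s' q ::ₘ .free c ::ₘ rest) := by
  obtain ⟨hA, hN, hMB, hU, hMt, hS, hD, hO, hC⟩ := h
  have hb : ∀ {p' : Point} {α : Act},
      Bd (.selected s p ::ₘ .selected s' q ::ₘ .matched c p q ::ₘ rest) p' α →
      Bd (.done s p ::ₘ .done s' q ::ₘ .free c ::ₘ rest) p' α :=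
    fun h => h.mono (by simp)
  have hs := hS s p (by simp)
  have hs' := hS s' q (by simp)
  have hm := hMt c p q (by simp)
  have e1 := bd_sync (hN p) hm.1 hs.1 hs.2
  have e2 := bd_sync (hN q) hm.2 hs'.1 hs'.2
  have hA0 : P.map absS = Sum.inr s.acts ::ₘ Sum.inr s'.acts ::ₘ (rest.map wA).sum := by
    rw [hA]; simp [wA, ← Multiset.singleton_add]
  obtain ⟨x, hx, hx1, hA1⟩ := (Multiset.map_eq_cons _ _ _ _).2 hA0
  obtain ⟨P1, rfl⟩ := Multiset.exists_cons_of_mem hx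
  simp only [Multiset.erase_cons_head] at hA1
  obtain ⟨y, hy, hy1, hA2⟩ := (Multiset.map_eq_cons _ _ _ _).2 hA1
  obtain ⟨P2, rfl⟩ := Multiset.exists_cons_of_mem hy
  simp only [Multiset.erase_cons_head] at hA2
  cases x with
  | act α => simp [absS] at hx1
  | select αs =>
  cases y with
  | act α => simp [absS] at hy1
  | select βs =>
  simp only [absS, Sum.inr.injEq] at hx1 hy1
  have m1 : Act.inp c ∈ αs := by
    rw [← Multiset.mem_coe, hx1]; exact Multiset.mem_map_of_mem Prod.snd e1
  have m2 : Act.out c ∈ βs := by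
    rw [← Multiset.mem_coe, hy1]; exact Multiset.mem_map_of_mem Prod.snd e2
  refine ⟨_, PStep.comm αs βs c P2 m1 m2, ?_⟩
  refine ⟨?_, ?_, ?_, ?_, ?_, ?_, ?_, ?_, ?_⟩
  · simp only [Multiset.map_cons, Multiset.sum_cons, wA_done e1, wA_done e2, hA2]
    simp [wA, absS, ← Multiset.singleton_add]
  · simpa [wN] using hN
  · intro r
    have := hMB r
    simp [wM, wB] at this ⊢
    omega
  · intro r α hr
    exact hb (hU r α (by simpa using hr))
  · intro d r t hr
    have := hMt d r t (by simp at hr ⊢; tauto)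
    exact ⟨hb this.1, hb this.2⟩
  · intro s' r hr
    have := hS s' r (by simp at hr ⊢; tauto)
    simpa using this
  · intro s2 r hr
    simp at hr
    rcases hr with ⟨rfl, rfl⟩ | ⟨rfl, rfl⟩ | hr
    · exact hs.2
    · exact hs'.2
    · exact hD s2 r (by simpa using hr)
  · intro s' hs e he
    have := hO s' (by simpa using hs) e he
    simpa using this
  · intro αs h1 α h2
    have := hC αs (by simp at h1 ⊢; tauto) α h2
    simp [wC] at this ⊢
    omega

theorem good_IIIii {P : Program} {s : Sync} {p q : Point} {c : Chan} {rest : State}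
    (h : Good P (.selected s p ::ₘ .reject q ::ₘ .matched c p q ::ₘ rest)) :
    Good P (.retry s ::ₘ .free c ::ₘ rest) := by
  obtain ⟨hA, hN, hMB, hU, hMt, hS, hD, hO, hC⟩ := h
  have hb : ∀ {p' : Point} {α : Act},
      Bd (.selected s p ::ₘ .reject q ::ₘ .matched c p q ::ₘ rest) p' α →
      Bd (.retry s ::ₘ .free c ::ₘ rest) p' α :=
    fun h => h.mono (by simp)
  refine ⟨?_, ?_, ?_, ?_, ?_, ?_, ?_, ?_, ?_⟩
  · simpa [wA] using hA
  · simpa [wN] using hN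
  · intro r
    have := hMB r
    simp [wM, wB] at this ⊢
    omega
  · intro r α hr
    exact hb (hU r α (by simpa using hr))
  · intro d r t hr
    have := hMt d r t (by simp at hr ⊢; tauto)
    exact ⟨hb this.1, hb this.2⟩
  · intro s' r hr
    have := hS s' r (by simp at hr ⊢; tauto)
    simpa using this
  · intro s2 r hr
    exact hD s2 r (by simpa using hr)
  · intro s' hs e he
    have := hO s' (by simpa using hs) e he
    simpa using this
  · intro αs h1 α h2
    have := hC αs h1 α h2
    simp [wC] at this ⊢
    omega

theorem good_IIIiii {P : Program} {s : Sync} {p q : Point} {c : Chan} {rest : State}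
    (h : Good P (.reject p ::ₘ .selected s q ::ₘ .matched c p q ::ₘ rest)) :
    Good P (.retry s ::ₘ .free c ::ₘ rest) := by
  obtain ⟨hA, hN, hMB, hU, hMt, hS, hD, hO, hC⟩ := h
  have hb : ∀ {p' : Point} {α : Act},
      Bd (.reject p ::ₘ .selected s q ::ₘ .matched c p q ::ₘ rest) p' α →
      Bd (.retry s ::ₘ .free c ::ₘ rest) p' α :=
    fun h => h.mono (by simp)
  refine ⟨?_, ?_, ?_, ?_, ?_, ?_, ?_, ?_, ?_⟩
  · simpa [wA] using hA
  · simpa [wN] using hN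
  · intro r
    have := hMB r
    simp [wM, wB] at this ⊢
    omega
  · intro r α hr
    exact hb (hU r α (by simpa using hr))
  · intro d r t hr
    have := hMt d r t (by simp at hr ⊢; tauto)
    exact ⟨hb this.1, hb this.2⟩
  · intro s' r hr
    have := hS s' r (by simp at hr ⊢; tauto)
    simpa using this
  · intro s2 r hr
    exact hD s2 r (by simpa using hr)
  · intro s' hs e he
    have := hO s' (by simpa using hs) e he
    simpa using this
  · intro αs h1 α h2
    have := hC αs h1 α h2
    simp [wC] at this ⊢
    omega

theorem good_IIIiv {P : Program} {p q : Point} {c : Chan} {rest : State}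
    (h : Good P (.reject p ::ₘ .reject q ::ₘ .matched c p q ::ₘ rest)) :
    Good P (.free c ::ₘ rest) := by
  obtain ⟨hA, hN, hMB, hU, hMt, hS, hD, hO, hC⟩ := h
  have hb : ∀ {p' : Point} {α : Act},
      Bd (.reject p ::ₘ .reject q ::ₘ .matched c p q ::ₘ rest) p' α →
      Bd (.free c ::ₘ rest) p' α :=
    fun h => h.mono (by simp)
  refine ⟨?_, ?_, ?_, ?_, ?_, ?_, ?_, ?_, ?_⟩
  · simpa [wA] using hA
  · simpa [wN] using hN
  · intro r
    have := hMB r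
    simp [wM, wB] at this ⊢
    omega
  · intro r α hr
    exact hb (hU r α (by simpa using hr))
  · intro d r t hr
    have := hMt d r t (by simp at hr ⊢; tauto)
    exact ⟨hb this.1, hb this.2⟩
  · intro s' r hr
    have := hS s' r (by simpa using hr)
    simpa using this
  · intro s2 r hr
    exact hD s2 r (by simpa using hr)
  · intro s' hs e he
    have := hO s' (by simpa using hs) e he
    simpa using this
  · intro αs h1 α h2
    have := hC αs h1 α h2
    simp [wC] at this ⊢
    omega

theorem good_IVi {P : Program} {s : Sync} {p : Point} {α : Act} {rest : State}
    (hm : s.maps p α) (h : Good P (.done s p ::ₘ rest)) :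
    Good P (.released α ::ₘ rest) := by
  obtain ⟨hA, hN, hMB, hU, hMt, hS, hD, hO, hC⟩ := h
  have hb : ∀ {p' : Point} {β : Act},
      Bd (.done s p ::ₘ rest) p' β →
      Bd (.released α ::ₘ rest) p' β :=
    fun h => h.mono (by simp)
  refine ⟨?_, ?_, ?_, ?_, ?_, ?_, ?_, ?_, ?_⟩
  · simp only [Multiset.map_cons, Multiset.sum_cons, wA_done hm] at hA
    simpa [wA] using hA
  · simpa [wN] using hN
  · intro r
    have := hMB r
    simp [wM, wB] at this ⊢
    omega
  · intro r α hr
    exact hb (hU r α (by simpa using hr))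
  · intro d r t hr
    have := hMt d r t (by simpa using hr)
    exact ⟨hb this.1, hb this.2⟩
  · intro s' r hr
    have := hS s' r (by simpa using hr)
    simpa using this
  · intro s2 r hr
    exact hD s2 r (by simp at hr ⊢; tauto)
  · intro s' hs e he
    have := hO s' (by simpa using hs) e he
    simpa using this
  · intro αs h1 α h2
    have := hC αs h1 α h2
    simp [wC] at this ⊢
    omega

def binds (s : Sync) : State := s.1.map (fun e => SubState.unmatched e.1 e.2)

theorem binds_sum {M : Type} [AddCommMonoid M] (f : SubState → M) (s : Sync)
    (hf : ∀ p α, f (.unmatched p α) = 0) : ((binds s).map f).sum = 0 := by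
  simp [binds, hf]

theorem mem_binds {s : Sync} {x : SubState} :
    x ∈ binds s ↔ ∃ e ∈ s.1, SubState.unmatched e.1 e.2 = x := by
  simp only [binds, Multiset.mem_map]

theorem fresh_sum {rest : State} {p : Point} (h : ¬ State.HasPoint rest p) :
    (rest.map (wN p)).sum = 0 := by
  by_contra hc
  obtain ⟨x, hx, h1⟩ := exists_of_sum_pos (Nat.one_le_iff_ne_zero.2 hc)
  apply h
  refine ⟨x, hx, ?_⟩
  cases x <;> simp [wN, pointIn] at h1 ⊢
  all_goals exact Multiset.one_le_count_iff_mem.1 h1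

theorem good_IVii {P : Program} {s s' : Sync} {rest : State} (hacts : s'.acts = s.acts)
    (hfresh : ∀ p ∈ s'.dom, ¬ State.HasPoint rest p) (h : Good P (.retry s ::ₘ rest)) :
    Good P (.opened s' ::ₘ (binds s' + rest)) := by
  obtain ⟨hA, hN, hMB, hU, hMt, hS, hD, hO, hC⟩ := h
  have hb : ∀ {p' : Point} {β : Act},
      Bd (.retry s ::ₘ rest) p' β →
      Bd (.opened s' ::ₘ (binds s' + rest)) p' β :=
    fun h => h.mono (by simp; tauto)
  refine ⟨?_, ?_, ?_, ?_, ?_, ?_, ?_, ?_, ?_⟩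
  · simp only [Multiset.map_cons, Multiset.map_add, Multiset.sum_cons, Multiset.sum_add,
      binds_sum wA s' (fun _ _ => rfl)]
    simpa [wA, hacts] using hA
  · intro p
    simp only [Multiset.map_cons, Multiset.map_add, Multiset.sum_cons, Multiset.sum_add,
      binds_sum (wN p) s' (fun _ _ => rfl)]
    by_cases hp : p ∈ s'.dom
    · rw [fresh_sum (hfresh p hp), wN_opened hp]; simp
    · have := hN p
      simp [wN] at this
      simp [wN, Multiset.count_eq_zero_of_notMem hp, this]
  · intro r
    have := hMB r
    simp only [Multiset.map_cons, Multiset.map_add, Multiset.sum_cons, Multiset.sum_add,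
      binds_sum (wM r) s' (fun _ _ => rfl), binds_sum (wB r) s' (fun _ _ => rfl)]
    simpa [wM, wB] using this
  · intro r α hr
    simp only [Multiset.mem_cons, Multiset.mem_add, mem_binds] at hr
    rcases hr with hr | ⟨e, he, hr⟩ | hr
    · simp at hr
    · simp at hr
      obtain ⟨rfl, rfl⟩ := hr
      exact ⟨s', by simp, he⟩
    · exact hb (hU r α (by simpa using hr))
  · intro d r t hr
    have := hMt d r t (by simpa [mem_binds] using hr)
    exact ⟨hb this.1, hb this.2⟩
  · intro s' r hr
    have := hS s' r (by simpa [mem_binds] using hr)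
    simp at this ⊢
    tauto
  · intro s2 r hr
    exact hD s2 r (by simpa [mem_binds] using hr)
  · intro s2 hs e he
    simp [mem_binds] at hs
    rcases hs with rfl | hs
    · left
      simp only [Multiset.mem_cons, Multiset.mem_add, mem_binds]
      exact Or.inr (Or.inl ⟨e, he, rfl⟩)
    · have := hO s2 (by simpa using hs) e he
      simp at this ⊢
      tauto
  · intro αs h1 α h2
    have := hC αs h1 α h2
    simp only [Multiset.map_cons, Multiset.map_add, Multiset.sum_cons, Multiset.sum_add,
      binds_sum (wC α.chan) s' (fun _ _ => rfl)]
    simpa [wC] using this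

theorem good_step {P : Program} {σ σ' : State} (h : Good P σ) (hs : Step σ σ') :
    Good P σ' ∨ ∃ P', PStep P P' ∧ Good P' σ' := by
  cases hs with
  | rI p q c rest => exact Or.inl (good_I h)
  | rIIi p s rest hp => exact Or.inl (good_IIi hp h)
  | rIIii p s rest hp => exact Or.inl (good_IIii hp h)
  | rIIIi s s' p q c rest => exact Or.inr (good_IIIi h)
  | rIIIii s p q c rest => exact Or.inl (good_IIIii h)
  | rIIIiii s p q c rest => exact Or.inl (good_IIIiii h)
  | rIIIiv p q c rest => exact Or.inl (good_IIIiv h)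
  | rIVi s p α rest hm => exact Or.inl (good_IVi hm h)
  | rIVii s s' rest h1 h2 => exact Or.inl (good_IVii h1 h2 h)

theorem ar1 (K q p : ℕ) (h : p = q ∨ p < K) : p < K + q + 1 := by omega
theorem ar2 (q r p : ℕ) (h : p = q ∨ p = r) : p < q + r + 1 := by omega
theorem ar3 (K L p : ℕ) (h : p < K ∨ p < L) : p < K + L := by omega
theorem ar4 (q K : ℕ) (h : q + K < K) : False := by omega

theorem dom_bound (s : Sync) : ∃ K, ∀ p ∈ s.dom, p < K := by
  refine ⟨s.dom.sum + 1, fun p hp => ?_⟩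
  exact Nat.lt_succ_of_le (Multiset.single_le_sum (fun _ _ => Nat.zero_le _) p hp)

theorem pt_bound (x : SubState) : ∃ K, ∀ p, pointIn p x → p < K := by
  cases x with
  | unmatched q _ => exact ⟨q + 1, by simp [pointIn]⟩
  | candidate q => exact ⟨q + 1, by simp [pointIn]⟩
  | released _ => exact ⟨0, by simp [pointIn]⟩
  | free _ => exact ⟨0, by simp [pointIn]⟩
  | matched _ q r => exact ⟨q + r + 1, fun p h => ar2 q r p h⟩
  | opened s => exact dom_bound s
  | closed s => exact dom_bound s
  | selected s q =>
    obtain ⟨K, hK⟩ := dom_bound s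
    exact ⟨K + q + 1, fun p h => ar1 K q p (h.imp id (hK p))⟩
  | reject q => exact ⟨q + 1, by simp [pointIn]⟩
  | done s q =>
    obtain ⟨K, hK⟩ := dom_bound s
    exact ⟨K + q + 1, fun p h => ar1 K q p (h.imp id (hK p))⟩
  | retry s => exact dom_bound s

theorem st_bound (σ : State) : ∃ K, ∀ p, State.HasPoint σ p → p < K := by
  induction σ using Multiset.induction_on with
  | empty => exact ⟨0, by simp [State.HasPoint]⟩
  | cons x σ ih =>
    obtain ⟨K, hK⟩ := ih
    obtain ⟨L, hL⟩ := pt_bound x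
    refine ⟨K + L, ?_⟩
    rintro p ⟨y, hy, h⟩
    rcases Multiset.mem_cons.1 hy with rfl | hy
    · exact ar3 K L p (Or.inr (hL p h))
    · exact ar3 K L p (Or.inl (hK p ⟨y, hy, h⟩))

theorem exists_fresh (s : Sync) (rest : State) :
    ∃ s' : Sync, s'.acts = s.acts ∧ ∀ p ∈ s'.dom, ¬ State.HasPoint rest p := by
  obtain ⟨K, hK⟩ := st_bound rest
  refine ⟨⟨s.1.map (fun e => (e.1 + K, e.2)), ?_⟩, ?_, ?_⟩
  · have := Multiset.Nodup.map (f := fun n : ℕ => n + K) (fun a b h => by simpa using h) s.2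
    simpa [Multiset.map_map, Function.comp_def] using this
  · simp [Sync.acts, Multiset.map_map, Function.comp_def]
  · intro p hp hr
    have := hK p hr
    simp only [Sync.dom, Multiset.map_map, Multiset.mem_map, Function.comp] at hp
    obtain ⟨e, _, rfl⟩ := hp
    exact ar4 _ _ this

theorem two_cons {σ : State} {x y : SubState} (hx : x ∈ σ) (hy : y ∈ σ) (h : x ≠ y) :
    ∃ t, σ = x ::ₘ y ::ₘ t := by
  obtain ⟨t, rfl⟩ := Multiset.exists_cons_of_mem hx
  have hy' : y ∈ t := by
    rcases Multiset.mem_cons.1 hy with h' | h'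
    · exact absurd h'.symm h
    · exact h'
  obtain ⟨u, rfl⟩ := Multiset.exists_cons_of_mem hy'
  exact ⟨u, rfl⟩

theorem three_cons {σ : State} {x y z : SubState} (hx : x ∈ σ) (hy : y ∈ σ) (hz : z ∈ σ)
    (h : x ≠ y) (h1 : x ≠ z) (h2 : y ≠ z) : ∃ t, σ = x ::ₘ y ::ₘ z ::ₘ t := by
  obtain ⟨t, rfl⟩ := two_cons hx hy h
  have hz' : z ∈ t := by
    simp only [Multiset.mem_cons] at hz
    rcases hz with h' | h' | h'
    · exact absurd h'.symm h1
    · exact absurd h'.symm h2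
    · exact h'
  obtain ⟨u, rfl⟩ := Multiset.exists_cons_of_mem hz'
  exact ⟨u, rfl⟩

theorem one_le_ite {p : Prop} [Decidable p] : (1 ≤ if p then 1 else 0) ↔ p := by
  split_ifs <;> simp [*]

theorem blocked {P : Program} {σ : State} (h : Good P σ) (hc : ∀ p, SubState.candidate p ∉ σ)
    {p : Point} (hp : 1 ≤ (σ.map (wM p)).sum) :
    SubState.reject p ∈ σ ∨ ∃ s, SubState.selected s p ∈ σ := by
  rw [h.hMB p] at hp
  obtain ⟨x, hx, h1⟩ := exists_of_sum_pos hp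
  cases x <;> simp [wB, one_le_ite] at h1
  · exact absurd hx (hc _)
  · subst h1; exact Or.inr ⟨_, hx⟩
  · subst h1; exact Or.inl hx

theorem clear_step {P : Program} {σ : State} (h : Good P σ) (hT : (σ.map wT).sum ≠ 0) :
    ∃ σ', Step σ σ' ∧ ((Good P σ' ∧ (σ'.map wT).sum < (σ.map wT).sum) ∨
      ∃ P', PStep P P' ∧ Good P' σ') := by
  by_cases hc : ∃ p, SubState.candidate p ∈ σ
  · obtain ⟨p, hp⟩ := hc
    have h1 : 1 ≤ (σ.map (wM p)).sum := by
      rw [h.hMB p]; exact sum_pos_of_mem hp (by simp [wB])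
    obtain ⟨x, hx, h2⟩ := exists_of_sum_pos h1
    have hb : ∃ α, Bd σ p α := by
      cases x <;> simp [wM] at h2
      rename_i c q r
      have := h.hMt c q r hx
      by_cases hq : q = p
      · subst hq; exact ⟨_, this.1⟩
      · have : r = p := by
          by_contra hr
          simp [hq, hr] at h2
        subst this; exact ⟨_, (h.hMt _ _ _ hx).2⟩
    obtain ⟨α, s, hs, hm⟩ := hb
    have hd : p ∈ s.dom := mem_dom.2 ⟨_, hm⟩
    rcases hs with hs | hs
    · obtain ⟨t, rfl⟩ := two_cons hp hs (by simp)
      exact ⟨_, Step.rIIi p s t hd, Or.inl ⟨good_IIi hd h, by simp [wT]⟩⟩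
    · obtain ⟨t, rfl⟩ := two_cons hp hs (by simp)
      exact ⟨_, Step.rIIii p s t hd, Or.inl ⟨good_IIii hd h, by simp [wT]⟩⟩
  push Not at hc
  obtain ⟨x, hx, hx1⟩ := exists_of_sum_pos (Nat.one_le_iff_ne_zero.2 hT)
  cases x <;> simp [wT] at hx1
  · exact absurd hx (hc _)
  · rename_i c p q
    have hb := h.hMt c p q hx
    have hne : p ≠ q := by
      rintro rfl
      have := bd_fun (h.hN p) hb.1 hb.2
      simp at this
    have h1 := blocked h hc (p := p) (sum_pos_of_mem hx (by simp [wM]))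
    have h2 := blocked h hc (p := q) (sum_pos_of_mem hx (by simp [wM]))
    rcases h1 with h1 | ⟨s, h1⟩ <;> rcases h2 with h2 | ⟨s', h2⟩
    · obtain ⟨t, rfl⟩ := three_cons h1 h2 hx (by simp [hne]) (by simp) (by simp)
      exact ⟨_, Step.rIIIiv p q c t, Or.inl ⟨good_IIIiv h, by simp [wT]⟩⟩
    · obtain ⟨t, rfl⟩ := three_cons h1 h2 hx (by simp) (by simp) (by simp)
      exact ⟨_, Step.rIIIiii s' p q c t, Or.inl ⟨good_IIIiii h, by simp [wT]⟩⟩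
    · obtain ⟨t, rfl⟩ := three_cons h1 h2 hx (by simp) (by simp) (by simp)
      exact ⟨_, Step.rIIIii s p q c t, Or.inl ⟨good_IIIii h, by simp [wT]⟩⟩
    · obtain ⟨t, rfl⟩ := three_cons h1 h2 hx (by simp [hne]) (by simp) (by simp)
      exact ⟨_, Step.rIIIi s s' p q c t, Or.inr (good_IIIi h)⟩
  · rename_i s
    obtain ⟨t, rfl⟩ := Multiset.exists_cons_of_mem hx
    obtain ⟨s', h1, h2⟩ := exists_fresh s t
    refine ⟨_, Step.rIVii s s' t h1 h2, Or.inl ⟨good_IVii h1 h2 h, ?_⟩⟩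
    have := binds_sum wT s' (fun _ _ => rfl)
    simp only [binds] at this
    simp only [Multiset.map_cons, Multiset.map_add, Multiset.sum_cons, Multiset.sum_add, this]
    simp [wT]

theorem clear {P : Program} (n : ℕ) : ∀ {σ : State}, Good P σ → (σ.map wT).sum = n →
    (∃ σ', Relation.ReflTransGen Step σ σ' ∧ Good P σ' ∧ (σ'.map wT).sum = 0) ∨
    (∃ σ' P', Relation.TransGen Step σ σ' ∧ PStep P P' ∧ Good P' σ') := by
  induction n using Nat.strong_induction_on with
  | _ n ih =>
    intro σ h hn
    by_cases h0 : (σ.map wT).sum = 0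
    · exact Or.inl ⟨σ, .refl, h, h0⟩
    · obtain ⟨σ1, hs, ⟨hg, hlt⟩ | ⟨P', hP, hg⟩⟩ := clear_step h h0
      · rcases ih _ (hn ▸ hlt) hg rfl with ⟨σ2, h1, h2⟩ | ⟨σ2, P', h1, h2⟩
        · exact Or.inl ⟨σ2, .head hs h1, h2⟩
        · exact Or.inr ⟨σ2, P', .head hs h1, h2⟩
      · exact Or.inr ⟨σ1, P', .single hs, hP, hg⟩

theorem find_open {σ : State} (hsel : ∀ s p, SubState.selected s p ∉ σ)
    (hret : ∀ s, SubState.retry s ∉ σ) {X : Multiset Act} {T : Multiset (Act ⊕ Multiset Act)}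
    (h : (σ.map wA).sum = Sum.inr X ::ₘ T) :
    ∃ s t, σ = SubState.opened s ::ₘ t ∧ s.acts = X ∧ (t.map wA).sum = T := by
  have hm : Sum.inr X ∈ (σ.map wA).sum := by rw [h]; simp
  obtain ⟨x, hx, hX⟩ := Multiset.mem_bind.1 (show Sum.inr X ∈ σ.bind wA from hm)
  obtain ⟨t, rfl⟩ := Multiset.exists_cons_of_mem hx
  cases x with
  | opened s =>
    simp [wA] at hX
    subst hX
    refine ⟨s, t, rfl, rfl, ?_⟩
    simpa [wA] using h
  | selected s p => exact absurd hx (hsel s p)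
  | retry s => exact absurd hx (hret s)
  | _ => simp [wA] at hX

theorem progress0 {P : Program} {σ : State} (h : Good P σ) (h0 : (σ.map wT).sum = 0)
    (hP : ∃ Q, PStep P Q) :
    ∃ σ' P', Relation.TransGen Step σ σ' ∧ PStep P P' ∧ Good P' σ' := by
  have hz : ∀ x ∈ σ, wT x = 0 := by
    intro x hx
    by_contra hc
    have := sum_pos_of_mem (f := wT) hx (Nat.one_le_iff_ne_zero.2 hc)
    omega
  have hcand : ∀ p, SubState.candidate p ∉ σ := fun p hp => by simpa [wT] using hz _ hp
  have hmat : ∀ c p q, SubState.matched c p q ∉ σ := fun c p q hp => by simpa [wT] using hz _ hp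
  have hret : ∀ s, SubState.retry s ∉ σ := fun s hp => by simpa [wT] using hz _ hp
  have hsel : ∀ s p, SubState.selected s p ∉ σ := by
    intro s p hp
    have h1 : 1 ≤ (σ.map (wM p)).sum := by
      rw [h.hMB p]; exact sum_pos_of_mem hp (by simp [wB])
    obtain ⟨x, hx, h2⟩ := exists_of_sum_pos h1
    cases x <;> simp [wM] at h2
    exact hmat _ _ _ hx
  obtain ⟨Q, hQ⟩ := hP
  cases hQ with
  | comm αs βs c rest h1 h2 =>
  have hA := h.hA
  simp only [Multiset.map_cons, absS] at hA
  obtain ⟨s, t, hσ, ha, ht⟩ := find_open hsel hret hA.symm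
  have hsub : ∀ x ∈ t, x ∈ σ := fun x hx => by rw [hσ]; simp [hx]
  obtain ⟨s', t', rfl, ha', -⟩ := find_open (σ := t) (fun s p hp => hsel s p (hsub _ hp))
    (fun s hp => hret s (hsub _ hp)) ht
  have i1 : Act.inp c ∈ s.acts := by rw [ha]; exact h1
  have i2 : Act.out c ∈ s'.acts := by rw [ha']; exact h2
  obtain ⟨⟨p, α⟩, hp, hα⟩ := Multiset.mem_map.1 i1
  obtain ⟨⟨q, β⟩, hq, hβ⟩ := Multiset.mem_map.1 i2
  simp only at hα hβ
  subst hα hβ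
  have hu1 : SubState.unmatched p (.inp c) ∈ σ := by
    rcases h.hO s (by simp [hσ]) _ hp with h | h
    · exact h
    · exact absurd h (hcand _)
  have hu2 : SubState.unmatched q (.out c) ∈ σ := by
    rcases h.hO s' (by simp [hσ]) _ hq with h | h
    · exact h
    · exact absurd h (hcand _)
  have hf : SubState.free c ∈ σ := by
    have := h.hC αs (by simp) _ h1
    obtain ⟨x, hx, hx1⟩ := exists_of_sum_pos this
    cases x <;> simp [wC, Act.chan] at hx1
    · have hx2 := one_le_ite.1 hx1
      subst hx2; exact hx
    · exact absurd hx (hmat _ _ _)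
  rw [hσ] at hu1 hu2 hf
  simp only [Multiset.mem_cons, reduceCtorEq, false_or] at hu1 hu2 hf
  obtain ⟨τ, rfl⟩ := three_cons hu1 hu2 hf (by simp) (by simp) (by simp)
  have dp : p ∈ s.dom := mem_dom.2 ⟨_, hp⟩
  have dq : q ∈ s'.dom := mem_dom.2 ⟨_, hq⟩
  have e0 : σ = .unmatched p (.inp c) ::ₘ .unmatched q (.out c) ::ₘ .free c ::ₘ
      .opened s ::ₘ .opened s' ::ₘ τ := by
    rw [hσ]; simp only [← Multiset.singleton_add]; abel
  have s1 := Step.rI p q c (.opened s ::ₘ .opened s' ::ₘ τ)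
  rw [e0] at h
  have g1 := good_I h
  have e1 : (.candidate p ::ₘ .candidate q ::ₘ .matched c p q ::ₘ
      .opened s ::ₘ .opened s' ::ₘ τ : State) = .candidate p ::ₘ .opened s ::ₘ
      .candidate q ::ₘ .matched c p q ::ₘ .opened s' ::ₘ τ := by
    simp only [← Multiset.singleton_add]; abel
  rw [e1] at g1 s1
  have s2 := Step.rIIi p s (.candidate q ::ₘ .matched c p q ::ₘ .opened s' ::ₘ τ) dp
  have g2 := good_IIi dp g1
  have e2 : (.closed s ::ₘ .selected s p ::ₘ .candidate q ::ₘ .matched c p q ::ₘ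
      .opened s' ::ₘ τ : State) = .candidate q ::ₘ .opened s' ::ₘ .closed s ::ₘ .selected s p ::ₘ
      .matched c p q ::ₘ τ := by
    simp only [← Multiset.singleton_add]; abel
  rw [e2] at g2 s2
  have s3 := Step.rIIi q s' (.closed s ::ₘ .selected s p ::ₘ .matched c p q ::ₘ τ) dq
  have g3 := good_IIi dq g2
  have e3 : (.closed s' ::ₘ .selected s' q ::ₘ .closed s ::ₘ .selected s p ::ₘ
      .matched c p q ::ₘ τ : State) = .selected s p ::ₘ .selected s' q ::ₘ .matched c p q ::ₘ
      .closed s ::ₘ .closed s' ::ₘ τ := by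
    simp only [← Multiset.singleton_add]; abel
  rw [e3] at g3 s3
  have s4 := Step.rIIIi s s' p q c (.closed s ::ₘ .closed s' ::ₘ τ)
  obtain ⟨P', hP, hg⟩ := good_IIIi g3
  refine ⟨_, P', ?_, hP, hg⟩
  rw [e0]
  exact .head s1 (.head s2 (.head s3 (.single s4)))

def wD : SubState → ℕ
  | .done _ _ => 1
  | _ => 0

theorem flush {P : Program} (n : ℕ) : ∀ {σ : State}, Good P σ → (σ.map wD).sum = n →
    ∃ σ', Relation.ReflTransGen Step σ σ' ∧ Good P σ' ∧ (σ'.map wD).sum = 0 := by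
  induction n with
  | zero => exact fun h h0 => ⟨_, .refl, h, h0⟩
  | succ n ih =>
    intro σ h hn
    obtain ⟨x, hx, hx1⟩ := exists_of_sum_pos (f := wD) (σ := σ) (by omega)
    cases x <;> simp [wD] at hx1
    rename_i s p
    obtain ⟨α, hα⟩ := mem_dom.1 (h.hD s p hx)
    obtain ⟨t, rfl⟩ := Multiset.exists_cons_of_mem hx
    have hs := Step.rIVi s p α t hα
    obtain ⟨σ', h1, h2⟩ := ih (good_IVi hα h) (by simp [wD] at hn ⊢; omega)
    exact ⟨σ', .head hs h1, h2⟩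

theorem den_prog (P : Program) :
    Prog.den P = (P.map absS).filterMap (fun x => x.getLeft?) := by
  induction P using Multiset.induction_on with
  | empty => simp [Prog.den]
  | cons S P ih =>
    unfold Prog.den at ih ⊢
    rw [Multiset.cons_bind, ih]
    cases S with
    | act α => simp [absS]
    | select αs =>
      simp only [Multiset.map_cons, absS, zero_add]
      rw [Multiset.filterMap_cons_none _ _ rfl]

theorem filterMap_add' {α β : Type} (f : α → Option β) (s t : Multiset α) :
    (s + t).filterMap f = s.filterMap f + t.filterMap f := by
  induction s using Multiset.induction_on with
  | empty => simp
  | cons a s ih =>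
    cases h : f a with
    | none => simp [Multiset.filterMap_cons_none _ _ h, ih]
    | some b => simp [Multiset.filterMap_cons_some _ _ _ h, ih]

theorem den_state (σ : State) (h : (σ.map wD).sum = 0) :
    State.den σ = ((σ.map wA).sum).filterMap (fun x => x.getLeft?) := by
  induction σ using Multiset.induction_on with
  | empty => simp [State.den]
  | cons x σ ih =>
    simp at h
    have ih := ih (by simpa using h.2)
    unfold State.den at ih ⊢
    rw [Multiset.cons_bind, ih, Multiset.map_cons, Multiset.sum_cons, filterMap_add']
    congr 1
    cases x <;> simp [wA, wD] at h ⊢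
    all_goals rfl

theorem good_isSim : IsSim Good := by
  intro P σ h
  refine ⟨?_, ?_, ?_⟩
  · obtain ⟨σ', h1, h2, h3⟩ := flush _ h rfl
    exact ⟨σ', h1, by rw [den_prog, den_state _ h3, h2.hA]⟩
  · intro σ' hs
    rcases good_step h hs with hg | ⟨P', hP, hg⟩
    · exact ⟨P, .refl, hg⟩
    · exact ⟨P', .single hP, hg⟩
  · intro hP
    rcases clear _ h rfl with ⟨σ1, h1, h2, h3⟩ | h1
    · obtain ⟨σ2, P', h4, h5⟩ := progress0 h2 h3 hP
      exact ⟨σ2, P', Relation.TransGen.trans_right h1 h4, h5⟩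
    · exact h1

theorem frees_sum {M : Type} [AddCommMonoid M] (f : SubState → M) (C : Multiset Chan)
    (hf : ∀ c, f (.free c) = 0) : ((C.map SubState.free).map f).sum = 0 := by
  simp [hf]

def L (l : List (Stmt × Sync × Multiset SubState)) : State := (l.map fun e => e.2.2).sum

theorem L_cons (e) (l) : L (e :: l) = e.2.2 + L l := by simp [L]

theorem unit_cases {S : Stmt} {s : Sync} {m : State} (h : compUnit S s m) :
    (∃ α, S = .act α ∧ s.1 = 0 ∧ m = {SubState.released α}) ∨
    (∃ αs, S = .select αs ∧ s.acts = ↑αs ∧ m = SubState.opened s ::ₘ binds s) := by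
  cases S with
  | act α => exact Or.inl ⟨α, rfl, h⟩
  | select αs => exact Or.inr ⟨αs, rfl, h⟩

theorem L_mem {l : List (Stmt × Sync × Multiset SubState)}
    (hl : ∀ e ∈ l, compUnit e.1 e.2.1 e.2.2) {x : SubState} (hx : x ∈ L l) :
    (∃ α, x = .released α) ∨ (∃ s : Sync, SubState.opened s ∈ L l ∧ binds s ≤ L l ∧
      (x = .opened s ∨ x ∈ binds s)) := by
  induction l with
  | nil => simp [L] at hx
  | cons e l ih =>
    have ih := ih (fun e he => hl e (by simp [he]))
    have hu := unit_cases (hl e (by simp))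
    rw [L_cons] at hx ⊢
    rcases Multiset.mem_add.1 hx with hx | hx
    · rcases hu with ⟨α, -, -, hm⟩ | ⟨αs, -, -, hm⟩
      · rw [hm] at hx
        exact Or.inl ⟨α, by simpa using hx⟩
      · rw [hm] at hx ⊢
        refine Or.inr ⟨e.2.1, by simp, ?_, by simpa using hx⟩
        exact (Multiset.le_cons_self _ _).trans (Multiset.le_add_right _ _)
    · rcases ih hx with h | ⟨s, h1, h2, h3⟩
      · exact Or.inl h
      · exact Or.inr ⟨s, by simp [h1], h2.trans (Multiset.le_add_left _ _), h3⟩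

theorem L_A {l : List (Stmt × Sync × Multiset SubState)}
    (hl : ∀ e ∈ l, compUnit e.1 e.2.1 e.2.2) :
    (↑(l.map fun e => e.1) : Multiset Stmt).map absS = ((L l).map wA).sum := by
  induction l with
  | nil => simp [L]
  | cons e l ih =>
    have ih := ih (fun e he => hl e (by simp [he]))
    have hu := unit_cases (hl e (by simp))
    rw [L_cons, List.map_cons, ← Multiset.cons_coe, Multiset.map_cons, ih, Multiset.map_add,
      Multiset.sum_add, ← Multiset.singleton_add]
    congr 1
    rcases hu with ⟨α, h1, -, h2⟩ | ⟨αs, h1, h3, h2⟩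
    · rw [h1, h2]; simp [absS, wA]
    · rw [h1, h2, Multiset.map_cons, Multiset.sum_cons, binds_sum wA _ (fun _ _ => rfl)]
      simp [absS, wA, h3]

theorem L_N {l : List (Stmt × Sync × Multiset SubState)}
    (hl : ∀ e ∈ l, compUnit e.1 e.2.1 e.2.2) (p : Point) :
    ((L l).map (wN p)).sum ≤ (l.map (fun e => e.2.1.dom.count p)).sum := by
  induction l with
  | nil => simp [L]
  | cons e l ih =>
    have ih := ih (fun e he => hl e (by simp [he]))
    have hu := unit_cases (hl e (by simp))
    rw [L_cons, Multiset.map_add, Multiset.sum_add, List.map_cons, List.sum_cons]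
    refine add_le_add ?_ ih
    rcases hu with ⟨α, h1, -, h2⟩ | ⟨αs, h1, h3, h2⟩
    · rw [h2]; simp [wN]
    · rw [h2, Multiset.map_cons, Multiset.sum_cons, binds_sum (wN p) _ (fun _ _ => rfl)]
      simp [wN]

theorem pw_N {l : List (Stmt × Sync × Multiset SubState)}
    (h : List.Pairwise (fun e e' => ∀ p : Point, p ∈ e.2.1.dom → p ∈ e'.2.1.dom → False) l)
    (p : Point) : (l.map (fun e => e.2.1.dom.count p)).sum ≤ 1 := by
  induction l with
  | nil => simp
  | cons e l ih =>
    rw [List.pairwise_cons] at h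
    have ih := ih h.2
    rw [List.map_cons, List.sum_cons]
    by_cases hp : p ∈ e.2.1.dom
    · have : (l.map (fun e => e.2.1.dom.count p)).sum = 0 := by
        apply List.sum_eq_zero
        intro n hn
        obtain ⟨e', he', rfl⟩ := List.mem_map.1 hn
        exact Multiset.count_eq_zero_of_notMem (fun hc => h.1 e' he' p hp hc)
      rw [this, dom_count hp]
    · rw [Multiset.count_eq_zero_of_notMem hp]
      omega

theorem good_init (P : Program) (σ : State) (h : Compiles P σ) : Good P σ := by
  obtain ⟨l, hP, hl, hpw, hσ⟩ := h
  change σ = _ + L l at hσ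
  have hmem : ∀ x ∈ σ, (∃ c, x = .free c) ∨ (∃ α, x = .released α) ∨
      (∃ s : Sync, SubState.opened s ∈ σ ∧ binds s ≤ σ ∧ (x = .opened s ∨ x ∈ binds s)) := by
    intro x hx
    rw [hσ] at hx
    rcases Multiset.mem_add.1 hx with hx | hx
    · obtain ⟨c, -, rfl⟩ := Multiset.mem_map.1 hx
      exact Or.inl ⟨c, rfl⟩
    · right
      rcases L_mem hl hx with h | ⟨s, h1, h2, h3⟩
      · exact Or.inl h
      · exact Or.inr ⟨s, by rw [hσ]; simp [h1], by
          rw [hσ]; exact h2.trans (Multiset.le_add_left _ _), h3⟩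
  have hM : ∀ p, ∀ x ∈ σ, wM p x = 0 ∧ wB p x = 0 := by
    intro p x hx
    rcases hmem x hx with ⟨c, rfl⟩ | ⟨α, rfl⟩ | ⟨s, -, -, rfl | hb⟩
    · exact ⟨rfl, rfl⟩
    · exact ⟨rfl, rfl⟩
    · exact ⟨rfl, rfl⟩
    · obtain ⟨e, -, rfl⟩ := mem_binds.1 hb
      exact ⟨rfl, rfl⟩
  refine ⟨?_, ?_, ?_, ?_, ?_, ?_, ?_, ?_, ?_⟩
  · rw [hσ, Multiset.map_add, Multiset.sum_add, frees_sum wA _ (fun _ => rfl), ← L_A hl, hP,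
      zero_add]
  · intro p
    rw [hσ, Multiset.map_add, Multiset.sum_add, frees_sum (wN p) _ (fun _ => rfl), zero_add]
    exact (L_N hl p).trans (pw_N hpw p)
  · intro p
    have : ∀ x ∈ σ, wM p x = wB p x := fun x hx => by rw [(hM p x hx).1, (hM p x hx).2]
    rw [Multiset.map_congr rfl this]
  · intro p α hx
    rcases hmem _ hx with ⟨c, h⟩ | ⟨α, h⟩ | ⟨s, h1, -, h | hb⟩
    · simp at h
    · simp at h
    · simp at h
    · obtain ⟨e, he, h⟩ := mem_binds.1 hb
      simp at h
      obtain ⟨rfl, rfl⟩ := h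
      exact ⟨s, Or.inl h1, he⟩
  · intro c p q hx
    have := (hM p _ hx).1
    simp [wM] at this
  · intro s p hx
    have := (hM p _ hx).2
    simp [wB] at this
  · intro s p hx
    rcases hmem _ hx with ⟨c, h⟩ | ⟨α, h⟩ | ⟨s, h1, -, h | hb⟩
    · simp at h
    · simp at h
    · simp at h
    · obtain ⟨e, he, h⟩ := mem_binds.1 hb
      simp at h
  · intro s hx e he
    rcases hmem _ hx with ⟨c, h⟩ | ⟨α, h⟩ | ⟨s, h1, h2, h | hb⟩
    · simp at h
    · simp at h
    · simp at h
      subst h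
      exact Or.inl (Multiset.mem_of_le h2 (mem_binds.2 ⟨e, he, rfl⟩))
    · obtain ⟨e, he, h⟩ := mem_binds.1 hb
      simp at h
  · intro αs h1 α h2
    have hc : α.chan ∈ Prog.chans P := by
      have hle : Stmt.chans (.select αs) ≤ Prog.chans P :=
        Multiset.le_sup (Multiset.mem_map_of_mem _ h1)
      apply hle
      simp only [Stmt.chans, List.mem_toFinset, List.mem_map]
      exact ⟨α, h2, rfl⟩
    have : SubState.free α.chan ∈ σ := by
      rw [hσ]
      exact Multiset.mem_add.2 (Or.inl (Multiset.mem_map_of_mem _ hc))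
    exact sum_pos_of_mem this (by simp [wC])

/-- **Correctness (Theorem 1).** Every program is related by the
bisimulation `~` to its compiled state. -/
theorem correctness (P : Program) (σ : State) (h : Compiles P σ) :
    Bisim P σ := by
  exact ⟨Good, good_isSim, good_init P σ h⟩

end CML
end

section
/- Suppose ⊢(νP)Πς⃗, and let p, q ∈ P be points such that the bindings p ↦ c and q ↦ c̄ occur in ς⃗ for some channel c. Then (νP)Πς⃗ →* (νP)Πς⃗' for some ς⃗' such that ⊙_c occurs in ς⃗'; that is, the machine can always eventually make channel c free. -/
/-
Formalization of the distributed event-synchronization protocol of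
"Event Synchronization by Lightweight Message Passing" (Chaudhuri).

Source language: programs are multisets (parallel compositions, up to
structural congruence) of statements, each either an action or a
`select` over a list of actions.

Abstract machine: states are multisets of sub-states (parallel
composition up to structural congruence; name restriction is handled
by freshness side conditions on transitions).
-/

namespace CML

theorem resolve_aux (τ : State) (a : Point) (s : Sync) (ha : a ∈ s.dom)
    (hs : SubState.opened s ∈ τ ∨ SubState.closed s ∈ τ)
    (h : SubState.candidate a ∈ τ ∨ SubState.selected s a ∈ τ ∨ SubState.reject a ∈ τ) :
    ∃ τ' : State, Relation.ReflTransGen Step τ τ' ∧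
      (SubState.selected s a ∈ τ' ∨ SubState.reject a ∈ τ') ∧
      (∀ x ∈ τ, x ≠ .candidate a → (∀ t, x ≠ .opened t) → x ∈ τ') ∧
      (∀ t, (SubState.opened t ∈ τ ∨ SubState.closed t ∈ τ) →
        (SubState.opened t ∈ τ' ∨ SubState.closed t ∈ τ')) := by
  rcases h with h | h
  · obtain ⟨r, rfl⟩ := Multiset.exists_cons_of_mem h
    rcases hs with hs | hs
    · have hs : SubState.opened s ∈ r := by simpa using hs
      obtain ⟨r, rfl⟩ := Multiset.exists_cons_of_mem hs
      refine ⟨_, .single (Step.rIIi a s r ha), by simp, ?_, ?_⟩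
      · intro x hx h1 h2
        have := h2 s
        simp_all
      · intro t ht
        simp only [Multiset.mem_cons, SubState.opened.injEq, SubState.closed.injEq,
          reduceCtorEq, false_or] at ht ⊢
        tauto
    · have hs : SubState.closed s ∈ r := by simpa using hs
      obtain ⟨r, rfl⟩ := Multiset.exists_cons_of_mem hs
      refine ⟨_, .single (Step.rIIii a s r ha), by simp, ?_, ?_⟩
      · intro x hx h1 h2
        simp only [Multiset.mem_cons] at hx ⊢
        tauto
      · intro t ht
        simp only [Multiset.mem_cons, SubState.opened.injEq, SubState.closed.injEq,
          reduceCtorEq, false_or] at ht ⊢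
        tauto
  · exact ⟨τ, .refl, h, fun x hx _ _ => hx, fun t ht => ht⟩

theorem split3 {τ : State} {x y z : SubState} (hx : x ∈ τ) (hy : y ∈ τ) (hz : z ∈ τ)
    (hxy : x ≠ y) (hxz : x ≠ z) (hyz : y ≠ z) : ∃ r, τ = x ::ₘ y ::ₘ z ::ₘ r := by
  obtain ⟨r, rfl⟩ := Multiset.exists_cons_of_mem hx
  have hy : y ∈ r := by simpa [hxy.symm] using hy
  have hz : z ∈ r := by simpa [hxz.symm] using hz
  obtain ⟨r, rfl⟩ := Multiset.exists_cons_of_mem hy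
  have hz : z ∈ r := by simpa [hyz.symm] using hz
  obtain ⟨r, rfl⟩ := Multiset.exists_cons_of_mem hz
  exact ⟨r, rfl⟩

theorem fire_aux (τ : State) (a b : Point) (s s' : Sync) (c : Chan) (hab : a ≠ b)
    (hm : SubState.matched c a b ∈ τ)
    (ha : SubState.selected s a ∈ τ ∨ SubState.reject a ∈ τ)
    (hb : SubState.selected s' b ∈ τ ∨ SubState.reject b ∈ τ) :
    ∃ τ' : State, Step τ τ' ∧ SubState.free c ∈ τ' := by
  rcases ha with ha | ha <;> rcases hb with hb | hb <;>
    obtain ⟨r, rfl⟩ := split3 ha hb hm (by simp [hab]) (by simp) (by simp)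
  · exact ⟨_, Step.rIIIi s s' a b c r, by simp⟩
  · exact ⟨_, Step.rIIIii s a b c r, by simp⟩
  · exact ⟨_, Step.rIIIiii s' a b c r, by simp⟩
  · exact ⟨_, Step.rIIIiv a b c r, by simp⟩

/-- **Lemma 3.** If a state satisfies the invariants and contains two
unmatched points bound to complementary actions on a channel `c`, then
the machine can eventually make `c` free. -/
theorem channel_eventually_free (σ : State) (p q : Point) (c : Chan)
    (hinv : Inv σ)
    (hp : SubState.unmatched p (.inp c) ∈ σ)
    (hq : SubState.unmatched q (.out c) ∈ σ) :
    ∃ σ' : State, Relation.ReflTransGen Step σ σ' ∧ SubState.free c ∈ σ' := by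
  obtain ⟨h1, h2, -, -, h4⟩ := hinv
  by_cases hf : SubState.free c ∈ σ
  · exact ⟨σ, .refl, hf⟩
  have hc := h2 c ⟨_, hp, rfl⟩
  rw [Multiset.count_eq_zero_of_notMem hf] at hc
  have hpos : 0 < countMatch c σ := by omega
  obtain ⟨x, hx⟩ := Multiset.card_pos_iff_exists_mem.1 hpos
  obtain ⟨hx, hxm⟩ := Multiset.mem_filter.1 hx
  obtain ⟨a, b, rfl⟩ : ∃ a b, x = SubState.matched c a b := by
    cases x <;> simp [isMatchOn] at hxm
    subst hxm
    exact ⟨_, _, rfl⟩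
  obtain ⟨s, s', hs, hs', hsa, hsb, ha, hb⟩ := (h4 c a b).1 hx
  have hda : a ∈ s.dom := Multiset.mem_map.2 ⟨_, hsa, rfl⟩
  have hdb : b ∈ s'.dom := Multiset.mem_map.2 ⟨_, hsb, rfl⟩
  obtain ⟨hu, ha2⟩ := h1 a ⟨_, hx, Or.inl rfl⟩
  obtain ⟨-, hb2⟩ := h1 b ⟨_, hx, Or.inr rfl⟩
  have hab : a ≠ b := by
    rintro rfl
    obtain rfl := hu.unique ⟨hs, hda⟩ ⟨hs', hdb⟩
    have := Multiset.inj_on_of_nodup_map s.2 _ hsa _ hsb rfl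
    simp at this
  have key : ∀ t : Sync, σ.count (.opened t) + σ.count (.closed t) = 1 →
      (SubState.opened t ∈ σ ∨ SubState.closed t ∈ σ) := by
    intro t ht
    by_contra hcon
    push Not at hcon
    rw [Multiset.count_eq_zero_of_notMem hcon.1,
      Multiset.count_eq_zero_of_notMem hcon.2] at ht
    omega
  have hso := key s (ha2 s hs _ hsa).2
  have hso' := key s' (hb2 s' hs' _ hsb).2
  obtain ⟨τ, hτ, haτ, hpres, hoc⟩ := resolve_aux σ a s hda hso ha
  have hbτ : SubState.candidate b ∈ τ ∨ SubState.selected s' b ∈ τ ∨ SubState.reject b ∈ τ := by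
    rcases hb with hb | hb | hb
    · exact .inl (hpres _ hb (by simp [hab.symm]) (by simp))
    · exact .inr (.inl (hpres _ hb (by simp) (by simp)))
    · exact .inr (.inr (hpres _ hb (by simp) (by simp)))
  obtain ⟨υ, hυ, hbυ, hpres', -⟩ := resolve_aux τ b s' hdb (hoc _ hso') hbτ
  have haυ : SubState.selected s a ∈ υ ∨ SubState.reject a ∈ υ :=
    haτ.imp (fun h => hpres' _ h (by simp) (by simp)) (fun h => hpres' _ h (by simp) (by simp))
  have hmυ := hpres' _ (hpres _ hx (by simp) (by simp)) (by simp) (by simp)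
  obtain ⟨ω, hω, hfree⟩ := fire_aux υ a b s s' c hab hmυ haυ hbυ
  exact ⟨ω, (hτ.trans hυ).tail hω, hfree⟩

end CML
end

section
/- A busy channel can always eventually become free: suppose ⊢(νP)Πς⃗ and Match_c(p',q') occurs in ς⃗ for some channel c and points p', q' ∈ P. Then (νP)Πς⃗ →* (νP)Πς⃗' for some ς⃗' such that ⊙_c occurs in ς⃗'. -/
/-
Formalization of the distributed event-synchronization protocol of
"Event Synchronization by Lightweight Message Passing" (Chaudhuri).

Source language: programs are multisets (parallel compositions, up to
structural congruence) of statements, each either an action or a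
`select` over a list of actions.

Abstract machine: states are multisets of sub-states (parallel
composition up to structural congruence; name restriction is handled
by freshness side conditions on transitions).
-/

namespace CML

theorem step_candidate (σ : State) (p : Point) (s : Sync) (hp : p ∈ s.dom)
    (hc : SubState.candidate p ∈ σ)
    (hs : SubState.opened s ∈ σ ∨ SubState.closed s ∈ σ) :
    ∃ σ', Step σ σ' ∧ ((∃ s, SubState.selected s p ∈ σ') ∨ SubState.reject p ∈ σ') ∧
      SubState.closed s ∈ σ' ∧
      ∀ t ∈ σ, t ≠ SubState.candidate p → t ≠ SubState.opened s → t ∈ σ' := by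
  obtain ⟨r, rfl⟩ := Multiset.exists_cons_of_mem hc
  rcases hs with hs | hs
  · have hs' : SubState.opened s ∈ r := by simpa using hs
    obtain ⟨r, rfl⟩ := Multiset.exists_cons_of_mem hs'
    refine ⟨_, Step.rIIi p s r hp, Or.inl ⟨s, by simp⟩, by simp, ?_⟩
    intro t ht h1 h2
    simp only [Multiset.mem_cons] at ht ⊢
    tauto
  · have hs' : SubState.closed s ∈ r := by simpa using hs
    obtain ⟨r, rfl⟩ := Multiset.exists_cons_of_mem hs'
    refine ⟨_, Step.rIIii p s r hp, Or.inr (by simp), by simp, ?_⟩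
    intro t ht h1 h2
    simp only [Multiset.mem_cons] at ht ⊢
    tauto

theorem exists_three {σ : State} {a b m : SubState} (ha : a ∈ σ) (hb : b ∈ σ) (hm : m ∈ σ)
    (hab : b ≠ a) (ham : m ≠ a) (hbm : m ≠ b) : ∃ r : State, σ = a ::ₘ b ::ₘ m ::ₘ r := by
  obtain ⟨r, rfl⟩ := Multiset.exists_cons_of_mem ha
  have hb' : b ∈ r := by simpa [hab] using hb
  obtain ⟨r, rfl⟩ := Multiset.exists_cons_of_mem hb'
  have hm' : m ∈ r := by simpa [ham, hbm] using hm
  obtain ⟨r, rfl⟩ := Multiset.exists_cons_of_mem hm'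
  exact ⟨r, rfl⟩

theorem step_free (σ : State) (c : Chan) (p q : Point) (hpq : p ≠ q)
    (hm : SubState.matched c p q ∈ σ)
    (hp : (∃ s, SubState.selected s p ∈ σ) ∨ SubState.reject p ∈ σ)
    (hq : (∃ s, SubState.selected s q ∈ σ) ∨ SubState.reject q ∈ σ) :
    ∃ σ', Step σ σ' ∧ SubState.free c ∈ σ' := by
  rcases hp with ⟨s, hp⟩ | hp <;> rcases hq with ⟨s', hq⟩ | hq <;>
    obtain ⟨r, rfl⟩ := exists_three hp hq hm (by simp [Ne.symm hpq]) (by simp) (by simp)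
  · exact ⟨_, Step.rIIIi s s' p q c r, by simp⟩
  · exact ⟨_, Step.rIIIii s p q c r, by simp⟩
  · exact ⟨_, Step.rIIIiii s' p q c r, by simp⟩
  · exact ⟨_, Step.rIIIiv p q c r, by simp⟩

/-- A busy channel can always eventually become free: if a state
satisfies the invariants and contains `Match_c(p',q')`, then the machine
can reach a state containing `⊙_c`. -/
theorem busy_channel_eventually_free (σ : State) (c : Chan) (p' q' : Point)
    (hinv : Inv σ) (hm : SubState.matched c p' q' ∈ σ) :
    ∃ σ' : State, Relation.ReflTransGen Step σ σ' ∧ SubState.free c ∈ σ' := by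
  obtain ⟨h1, -, -, -, h4⟩ := hinv
  obtain ⟨s, s', hs, hs', hp, hq, tp, tq⟩ := (h4 c p' q').1 hm
  have Pp : σ.HasPoint p' := ⟨_, hm, Or.inl rfl⟩
  have Pq : σ.HasPoint q' := ⟨_, hm, Or.inr rfl⟩
  have dp : p' ∈ s.dom := Multiset.mem_map.2 ⟨_, hp, rfl⟩
  have dq : q' ∈ s'.dom := Multiset.mem_map.2 ⟨_, hq, rfl⟩
  have hpq : p' ≠ q' := by
    rintro rfl
    obtain rfl : s = s' := (h1 p' Pp).1.unique ⟨hs, dp⟩ ⟨hs', dq⟩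
    have := Multiset.inj_on_of_nodup_map s.2 _ hp _ hq rfl
    simp at this
  have oc : ∀ (p : Point) (t : Sync) (α : Act), σ.HasPoint p → σ.HasSync t → t.maps p α →
      SubState.opened t ∈ σ ∨ SubState.closed t ∈ σ := by
    intro p t α hP hT hM
    have := ((h1 p hP).2 t hT α hM).2
    by_contra! hcon
    rw [Multiset.count_eq_zero_of_notMem hcon.1, Multiset.count_eq_zero_of_notMem hcon.2] at this
    simp at this
  have os := oc _ _ _ Pp hs hp
  have os' := oc _ _ _ Pq hs' hq
  -- first resolve `p'`
  obtain ⟨σ₁, r1, m1, t1, q1, o1⟩ : ∃ σ₁, Relation.ReflTransGen Step σ σ₁ ∧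
      SubState.matched c p' q' ∈ σ₁ ∧
      ((∃ s, SubState.selected s p' ∈ σ₁) ∨ SubState.reject p' ∈ σ₁) ∧
      (SubState.candidate q' ∈ σ₁ ∨ SubState.selected s' q' ∈ σ₁ ∨ SubState.reject q' ∈ σ₁) ∧
      (SubState.opened s' ∈ σ₁ ∨ SubState.closed s' ∈ σ₁) := by
    rcases tp with tp | tp | tp
    · obtain ⟨σ₁, st, a, b, k⟩ := step_candidate σ p' s dp tp os
      refine ⟨σ₁, .single st, k _ hm (by simp) (by simp), a, ?_, ?_⟩
      · rcases tq with tq | tq | tq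
        · exact Or.inl (k _ tq (by simp [Ne.symm hpq]) (by simp))
        · exact Or.inr (Or.inl (k _ tq (by simp) (by simp)))
        · exact Or.inr (Or.inr (k _ tq (by simp) (by simp)))
      · by_cases e : s' = s
        · subst e
          exact Or.inr b
        · rcases os' with os' | os'
          · exact Or.inl (k _ os' (by simp) (by simpa using e))
          · exact Or.inr (k _ os' (by simp) (by simp))
    · exact ⟨σ, .refl, hm, Or.inl ⟨s, tp⟩, tq, os'⟩
    · exact ⟨σ, .refl, hm, Or.inr tp, tq, os'⟩
  -- then resolve `q'`
  obtain ⟨σ₂, r2, m2, t2, q2⟩ : ∃ σ₂, Relation.ReflTransGen Step σ₁ σ₂ ∧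
      SubState.matched c p' q' ∈ σ₂ ∧
      ((∃ s, SubState.selected s p' ∈ σ₂) ∨ SubState.reject p' ∈ σ₂) ∧
      ((∃ s, SubState.selected s q' ∈ σ₂) ∨ SubState.reject q' ∈ σ₂) := by
    rcases q1 with tq | tq | tq
    · obtain ⟨σ₂, st, a, b, k⟩ := step_candidate σ₁ q' s' dq tq o1
      refine ⟨σ₂, .single st, k _ m1 (by simp) (by simp), ?_, a⟩
      rcases t1 with ⟨u, t1⟩ | t1
      · exact Or.inl ⟨u, k _ t1 (by simp) (by simp)⟩
      · exact Or.inr (k _ t1 (by simp) (by simp))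
    · exact ⟨σ₁, .refl, m1, t1, Or.inl ⟨s', tq⟩⟩
    · exact ⟨σ₁, .refl, m1, t1, Or.inr tq⟩
  obtain ⟨σ₃, st, hf⟩ := step_free σ₂ c p' q' hpq m2 t2 q2
  exact ⟨σ₃, (r1.trans r2).tail st, hf⟩

end CML
end

section
/- Safety of the compilation (corollary of the Correctness theorem): let 𝒫₀ be a program and σ₀ its compiled state. For every state σ with σ₀ →* σ, there is a program 𝒫 with 𝒫₀ →* 𝒫 and a state σ' with σ →* σ' such that ⌜𝒫⌝ = ⌜σ'⌝. -/
/-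
Formalization of the distributed event-synchronization protocol of
"Event Synchronization by Lightweight Message Passing" (Chaudhuri).

Source language: programs are multisets (parallel compositions, up to
structural congruence) of statements, each either an action or a
`select` over a list of actions.

Abstract machine: states are multisets of sub-states (parallel
composition up to structural congruence; name restriction is handled
by freshness side conditions on transitions).
-/

namespace CML

/-- `ς` binds the point `p` to the action `α`. -/
def bindsTo (p : Point) (α : Act) : SubState → Prop
  | .unmatched q β => p = q ∧ α = β
  | .candidate _ => False
  | .released _ => False
  | .free _ => False
  | .matched c q r => (p = q ∧ α = .inp c) ∨ (p = r ∧ α = .out c)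
  | .opened s => (p, α) ∈ s.1
  | .closed s => (p, α) ∈ s.1
  | .selected s _ => (p, α) ∈ s.1
  | .reject _ => False
  | .done s _ => (p, α) ∈ s.1
  | .retry s => (p, α) ∈ s.1

def wfSub : SubState → Prop
  | .selected s p => p ∈ s.dom
  | .done s p => p ∈ s.dom
  | _ => True

structure Good_s11 (σ : State) : Prop where
  func : ∀ p α β, (∃ ς ∈ σ, bindsTo p α ς) → (∃ ς ∈ σ, bindsTo p β ς) → α = β
  wf : ∀ ς ∈ σ, wfSub ς

def absStmt : Stmt → Act ⊕ Multiset Act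
  | .act α => .inl α
  | .select αs => .inr ↑αs

def absSub : SubState → Multiset (Act ⊕ Multiset Act)
  | .released α => {.inl α}
  | .opened s => {.inr s.acts}
  | .selected s _ => {.inr s.acts}
  | .retry s => {.inr s.acts}
  | .done s p => (s.1.filter (fun e => e.1 = p)).map (fun e => .inl e.2)
  | _ => 0

def absState (σ : State) : Multiset (Act ⊕ Multiset Act) := σ.bind absSub

def absDen (X : Multiset (Act ⊕ Multiset Act)) : Multiset Act :=
  X.bind fun x => match x with
    | .inl α => {α}
    | .inr _ => 0

theorem sync_func (s : Sync) {p : Point} {α β : Act}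
    (h1 : (p, α) ∈ s.1) (h2 : (p, β) ∈ s.1) : α = β := by
  have := Multiset.inj_on_of_nodup_map s.2 _ h1 _ h2 rfl
  simpa using this

theorem absSub_done (s : Sync) {p : Point} {α : Act} (h : (p, α) ∈ s.1) :
    absSub (.done s p) = {.inl α} := by
  have hn : s.1.Nodup := Multiset.Nodup.of_map _ s.2
  have : s.1.filter (fun e => e.1 = p) = {(p, α)} := by
    rw [Multiset.Nodup.ext (hn.filter _) (Multiset.nodup_singleton _)]
    rintro ⟨q, β⟩
    simp only [Multiset.mem_filter, Multiset.mem_singleton, Prod.mk.injEq]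
    constructor
    · rintro ⟨h1, rfl⟩
      exact ⟨rfl, sync_func s h1 h⟩
    · rintro ⟨rfl, rfl⟩
      exact ⟨h, rfl⟩
  simp [absSub, this]

theorem pointIn_of_binds {p : Point} {α : Act} {ς : SubState} (h : bindsTo p α ς) :
    pointIn p ς := by
  cases ς <;> simp only [bindsTo, pointIn, mem_dom] at * <;> grind

theorem Good_s11.mono {σ σ' : State} (h : Good_s11 σ)
    (hb : ∀ p α, (∃ ς ∈ σ', bindsTo p α ς) → (∃ ς ∈ σ, bindsTo p α ς))
    (hw : ∀ ς ∈ σ', wfSub ς) : Good_s11 σ' :=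
  ⟨fun p α β h1 h2 => h.func p α β (hb _ _ h1) (hb _ _ h2), hw⟩

theorem good_step_s11 {σ σ' : State} (h : Good_s11 σ) (hs : Step σ σ') : Good_s11 σ' := by
  have hw := h.wf
  cases hs with
  | rIVii s s' rest hacts hfresh =>
    have key : ∀ p α, (∃ ς ∈ (.opened s' ::ₘ
        (s'.1.map (fun e => SubState.unmatched e.1 e.2) + rest)), bindsTo p α ς) →
        (p, α) ∈ s'.1 ∨ (∃ ς ∈ rest, bindsTo p α ς) := by
      rintro p α ⟨ς, hς, hb⟩
      simp only [Multiset.mem_cons, Multiset.mem_add, Multiset.mem_map] at hς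
      rcases hς with rfl | ⟨e, he, rfl⟩ | hς
      · exact .inl hb
      · obtain ⟨rfl, rfl⟩ := hb
        exact .inl he
      · exact .inr ⟨ς, hς, hb⟩
    have no : ∀ p α β, (p, α) ∈ s'.1 → ¬ (∃ ς ∈ rest, bindsTo p β ς) := by
      rintro p α β h1 ⟨ς, hς, hb⟩
      exact hfresh p (mem_dom.2 ⟨α, h1⟩) ⟨ς, hς, pointIn_of_binds hb⟩
    refine ⟨fun p α β h1 h2 => ?_, ?_⟩
    · rcases key _ _ h1 with h1 | h1 <;> rcases key _ _ h2 with h2 | h2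
      · exact sync_func s' h1 h2
      · exact (no _ _ _ h1 h2).elim
      · exact (no _ _ _ h2 h1).elim
      · obtain ⟨a, ha, ha'⟩ := h1
        obtain ⟨b, hb, hb'⟩ := h2
        exact h.func p α β ⟨a, Multiset.mem_cons_of_mem ha, ha'⟩
          ⟨b, Multiset.mem_cons_of_mem hb, hb'⟩
    · intro ς hς
      simp only [Multiset.mem_cons, Multiset.mem_add, Multiset.mem_map] at hς
      rcases hς with rfl | ⟨e, he, rfl⟩ | hς
      · trivial
      · trivial
      · exact hw ς (Multiset.mem_cons_of_mem hς)
  | _ =>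
    refine h.mono ?_ ?_
    · intro p α hb
      simp only [Multiset.mem_cons, exists_eq_or_imp, bindsTo] at hb ⊢
      tauto
    · simp only [Multiset.mem_cons, forall_eq_or_imp, wfSub] at hw ⊢
      tauto

theorem sim_step {P : Program} {σ σ' : State} (h : Good_s11 σ) (hs : Step σ σ')
    (hR : P.map absStmt = absState σ) :
    ∃ P', Relation.ReflTransGen PStep P P' ∧ P'.map absStmt = absState σ' := by
  cases hs with
  | rIIIi s s' p q c rest =>
    obtain ⟨α, hα⟩ := mem_dom.1 (h.wf (.selected s p) (by simp))
    obtain ⟨β, hβ⟩ := mem_dom.1 (h.wf (.selected s' q) (by simp))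
    have e1 : α = .inp c := h.func p _ _ ⟨.selected s p, by simp, hα⟩
      ⟨.matched c p q, by simp, .inl ⟨rfl, rfl⟩⟩
    have e2 : β = .out c := h.func q _ _ ⟨.selected s' q, by simp, hβ⟩
      ⟨.matched c p q, by simp, .inr ⟨rfl, rfl⟩⟩
    subst e1 e2
    have hR' : P.map absStmt = .inr s.acts ::ₘ .inr s'.acts ::ₘ absState rest := by
      rw [hR]; simp [absState, absSub]; exact Multiset.cons_swap _ _ _
    obtain ⟨S, hS, hS1, hS2⟩ := (Multiset.map_eq_cons _ _ _ _).2 hR'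
    obtain ⟨T, hT, hT1, hT2⟩ := (Multiset.map_eq_cons _ _ _ _).2 hS2
    cases S with
    | act a => simp [absStmt] at hS1
    | select αs =>
    cases T with
    | act a => simp [absStmt] at hT1
    | select βs =>
    simp only [absStmt, Sum.inr.injEq] at hS1 hT1
    refine ⟨_, .single (?_ : PStep P (.act (.inp c) ::ₘ .act (.out c) ::ₘ
      (P.erase (.select αs)).erase (.select βs))), ?_⟩
    · have := PStep.comm αs βs c ((P.erase (.select αs)).erase (.select βs)) ?_ ?_
      · rwa [Multiset.cons_erase hT, Multiset.cons_erase hS] at this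
      · rw [← Multiset.mem_coe, hS1]
        exact Multiset.mem_map.2 ⟨_, hα, rfl⟩
      · rw [← Multiset.mem_coe, hT1]
        exact Multiset.mem_map.2 ⟨_, hβ, rfl⟩
    · simp only [Multiset.map_cons, hT2, absState, Multiset.cons_bind, absSub_done s hα,
        absSub_done s' hβ, absStmt]
      simp [absSub]
      exact Multiset.cons_swap _ _ _
  | rIVi s p α rest hm =>
    refine ⟨P, .refl, hR.trans ?_⟩
    simp only [absState, Multiset.cons_bind, absSub_done s hm]
    rfl
  | rIVii s s' rest hacts hfresh =>
    refine ⟨P, .refl, hR.trans ?_⟩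
    have : (s'.1.map (fun e => SubState.unmatched e.1 e.2)).bind absSub = 0 := by
      simp [Multiset.bind_map, absSub]
    simp only [absState, Multiset.cons_bind, Multiset.add_bind, this, absSub, hacts, zero_add]
  | _ =>
    refine ⟨P, .refl, hR.trans ?_⟩
    simp [absState, absSub]

theorem flush_s11 (σ : State) : (∀ ς ∈ σ, wfSub ς) → ∀ rest : State,
    ∃ σ' : State, Relation.ReflTransGen Step (σ + rest) (σ' + rest) ∧
      absDen (absState σ) = State.den σ' := by
  induction σ using Multiset.induction_on with
  | empty => exact fun _ rest => ⟨0, .refl, by simp [absDen, absState, State.den]⟩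
  | cons a σ ih =>
    intro hw rest
    obtain ⟨σ', h1, h2⟩ := ih (fun ς hς => hw ς (Multiset.mem_cons_of_mem hς)) (a ::ₘ rest)
    have key : ∀ b : SubState, absDen (absSub a) = State.den {b} →
        absDen (absState (a ::ₘ σ)) = State.den (b ::ₘ σ') := by
      intro b hb
      simp only [absDen, absState, State.den, Multiset.cons_bind, Multiset.add_bind,
        Multiset.singleton_bind] at hb h2 ⊢
      rw [hb, h2]
    have h1' : Relation.ReflTransGen Step (a ::ₘ σ + rest) (a ::ₘ σ' + rest) := by
      simpa [Multiset.add_cons, Multiset.cons_add] using h1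
    cases a with
    | done s p =>
      obtain ⟨α, hα⟩ := mem_dom.1 (hw (.done s p) (by simp))
      refine ⟨.released α ::ₘ σ', h1'.tail ?_, key _ ?_⟩
      · rw [Multiset.cons_add, Multiset.cons_add]
        exact Step.rIVi s p α _ hα
      · rw [absSub_done s hα]
        simp [absDen, State.den]
    | _ =>
      refine ⟨_, h1', key _ ?_⟩
      simp [absSub, absDen, State.den]

theorem den_abs (P : Program) : Prog.den P = absDen (P.map absStmt) := by
  simp only [Prog.den, absDen, Multiset.bind_map]
  refine Multiset.bind_congr ?_
  intro S _
  cases S <;> rfl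

theorem unit_abs {e : Stmt × Sync × Multiset SubState} (h : compUnit e.1 e.2.1 e.2.2) :
    absState e.2.2 = {absStmt e.1} := by
  obtain ⟨S, s, m⟩ := e
  cases S with
  | act α => obtain ⟨_, rfl⟩ := h; simp [absState, absSub, absStmt]
  | select αs =>
    dsimp only at h
    obtain ⟨h, rfl⟩ := h
    simp [absState, absSub, absStmt, Multiset.bind_map, h]

theorem unit_binds {e : Stmt × Sync × Multiset SubState} (h : compUnit e.1 e.2.1 e.2.2)
    {ς : SubState} (hς : ς ∈ e.2.2) :
    wfSub ς ∧ ∀ p α, bindsTo p α ς → (p, α) ∈ e.2.1.1 := by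
  obtain ⟨S, s, m⟩ := e
  cases S with
  | act α =>
    obtain ⟨_, rfl⟩ := h
    simp only [Multiset.mem_singleton] at hς
    subst hς
    simp [wfSub, bindsTo]
  | select αs =>
    dsimp only at h
    obtain ⟨h, rfl⟩ := h
    simp only [Multiset.mem_cons, Multiset.mem_map] at hς
    rcases hς with rfl | ⟨e, he, rfl⟩
    · simp [wfSub, bindsTo]
    · refine ⟨trivial, ?_⟩
      rintro p α ⟨rfl, rfl⟩
      exact he

theorem abs_sum (l : List (Stmt × Sync × Multiset SubState))
    (h : ∀ e ∈ l, compUnit e.1 e.2.1 e.2.2) :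
    absState (l.map fun e => e.2.2).sum =
      Multiset.map absStmt (↑(l.map fun e => e.1) : Multiset Stmt) := by
  induction l with
  | nil => simp [absState]
  | cons a l ih =>
    have h1 := unit_abs (h a (by simp))
    have h2 := ih (fun e he => h e (by simp [he]))
    simp only [List.map_cons, List.sum_cons, ← Multiset.cons_coe, Multiset.map_cons, ← h2]
    simp only [absState, Multiset.add_bind] at h1 ⊢
    rw [h1]
    rfl

theorem mem_sum (l : List (Stmt × Sync × Multiset SubState)) (ς : SubState)
    (h : ς ∈ (l.map fun e => e.2.2).sum) : ∃ e ∈ l, ς ∈ e.2.2 := by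
  induction l with
  | nil => simp at h
  | cons a l ih =>
    simp only [List.map_cons, List.sum_cons, Multiset.mem_add] at h
    rcases h with h | h
    · exact ⟨a, by simp, h⟩
    · obtain ⟨e, he, h⟩ := ih h
      exact ⟨e, by simp [he], h⟩

theorem pair_func (l : List (Stmt × Sync × Multiset SubState))
    (h : List.Pairwise (fun e e' => ∀ p : Point, p ∈ e.2.1.dom → p ∈ e'.2.1.dom → False) l)
    (p : Point) (α β : Act) (h1 : ∃ e ∈ l, (p, α) ∈ e.2.1.1) (h2 : ∃ e ∈ l, (p, β) ∈ e.2.1.1) :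
    α = β := by
  obtain ⟨e, he, h1⟩ := h1
  obtain ⟨f, hf, h2⟩ := h2
  by_cases hef : e = f
  · subst hef
    exact sync_func _ h1 h2
  · have : Std.Symm (fun e e' : Stmt × Sync × Multiset SubState =>
        ∀ p : Point, p ∈ e.2.1.dom → p ∈ e'.2.1.dom → False) :=
      ⟨fun x y hxy p a b => hxy p b a⟩
    exact (h.forall he hf hef p
      (mem_dom.2 ⟨_, h1⟩) (mem_dom.2 ⟨_, h2⟩)).elim

theorem init_ok {P : Program} {σ : State} (h : Compiles P σ) :
    Good_s11 σ ∧ P.map absStmt = absState σ := by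
  obtain ⟨l, hP, hu, hpw, rfl⟩ := h
  have key : ∀ p α, (∃ ς ∈ Multiset.map SubState.free (Prog.chans P).val +
      (l.map fun e => e.2.2).sum, bindsTo p α ς) → ∃ e ∈ l, (p, α) ∈ e.2.1.1 := by
    rintro p α ⟨ς, hς, hb⟩
    rcases Multiset.mem_add.1 hς with hς | hς
    · obtain ⟨c, _, rfl⟩ := Multiset.mem_map.1 hς
      exact hb.elim
    · obtain ⟨e, he, hς⟩ := mem_sum l ς hς
      exact ⟨e, he, (unit_binds (hu e he) hς).2 p α hb⟩
  refine ⟨⟨fun p α β h1 h2 => pair_func l hpw p α β (key _ _ h1) (key _ _ h2), ?_⟩, ?_⟩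
  · intro ς hς
    rcases Multiset.mem_add.1 hς with hς | hς
    · obtain ⟨c, _, rfl⟩ := Multiset.mem_map.1 hς
      trivial
    · obtain ⟨e, he, hς⟩ := mem_sum l ς hς
      exact (unit_binds (hu e he) hς).1
  · have h0 : (Multiset.map SubState.free (Prog.chans P).val).bind absSub = 0 := by
      simp [Multiset.bind_map, absSub]
    have := abs_sum l hu
    rw [hP] at this
    rw [← this]
    simp only [absState, Multiset.add_bind, h0, zero_add]

/-- **Safety of the compilation** (corollary of the Correctness theorem):
every state reachable from the compiled state of a program corresponds
(after possibly some more machine steps) to a reduct of the program. -/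
theorem compilation_safety (P₀ : Program) (σ₀ σ : State)
    (hc : Compiles P₀ σ₀) (hr : Relation.ReflTransGen Step σ₀ σ) :
    ∃ (P : Program) (σ' : State),
      Relation.ReflTransGen PStep P₀ P ∧
      Relation.ReflTransGen Step σ σ' ∧
      Prog.den P = State.den σ' := by
  have main : ∃ P, Relation.ReflTransGen PStep P₀ P ∧ Good_s11 σ ∧ P.map absStmt = absState σ := by
    induction hr with
    | refl => exact ⟨P₀, .refl, init_ok hc⟩
    | tail _ hs ih =>
      obtain ⟨P, h1, h2, h3⟩ := ih
      obtain ⟨P', h4, h5⟩ := sim_step h2 hs h3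
      exact ⟨P', h1.trans h4, good_step_s11 h2 hs, h5⟩
  obtain ⟨P, h1, h2, h3⟩ := main
  obtain ⟨σ', h4, h5⟩ := flush_s11 σ h2.wf 0
  refine ⟨P, σ', h1, by simpa using h4, ?_⟩
  rw [den_abs, h3, h5]

end CML
end

section
/- Progress of the compilation (corollary of the Correctness theorem): let 𝒫₀ be a program that can reduce, and let σ₀ be its compiled state. Then there exist a program 𝒫' and a state σ' such that 𝒫₀ → 𝒫', σ₀ →⁺ σ', and ⌜σ'⌝ = ⌜𝒫'⌝. -/
/-
Formalization of the distributed event-synchronization protocol of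
"Event Synchronization by Lightweight Message Passing" (Chaudhuri).

Source language: programs are multisets (parallel compositions, up to
structural congruence) of statements, each either an action or a
`select` over a list of actions.

Abstract machine: states are multisets of sub-states (parallel
composition up to structural congruence; name restriction is handled
by freshness side conditions on transitions).
-/

namespace CML

theorem den_add (a b : State) : State.den (a + b) = State.den a + State.den b := by
  simp [State.den, Multiset.add_bind]

theorem den_cons (a : SubState) (b : State) :
    State.den (a ::ₘ b) = State.den {a} + State.den b := by
  rw [← Multiset.singleton_add, den_add]

theorem den_free (m : Multiset Chan) : State.den (m.map SubState.free) = 0 := by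
  induction m using Multiset.induction_on with
  | empty => simp [State.den]
  | cons a m ih => rw [Multiset.map_cons, den_cons, ih]; simp [State.den]

theorem den_unm (m : Multiset (Point × Act)) :
    State.den (m.map (fun e => SubState.unmatched e.1 e.2)) = 0 := by
  induction m using Multiset.induction_on with
  | empty => simp [State.den]
  | cons a m ih => rw [Multiset.map_cons, den_cons, ih]; simp [State.den]

theorem den_units (M : Multiset (Stmt × Sync × Multiset SubState))
    (h : ∀ e ∈ M, compUnit e.1 e.2.1 e.2.2) :
    State.den (M.map (fun e => e.2.2)).sum = Prog.den (M.map (fun e => e.1)) := by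
  induction M using Multiset.induction_on with
  | empty => simp [State.den, Prog.den]
  | cons a m ih =>
    rw [Multiset.map_cons, Multiset.sum_cons, den_add,
      ih (fun e he => h e (Multiset.mem_cons_of_mem he))]
    have ha := h a (Multiset.mem_cons_self a m)
    obtain ⟨S, s, u⟩ := a
    cases S with
    | act α =>
      obtain ⟨-, rfl⟩ := ha
      simp [State.den, Prog.den]
    | select αs =>
      obtain ⟨-, hu⟩ := ha
      dsimp only at hu
      subst hu
      rw [den_cons, den_unm]
      simp [State.den, Prog.den]

theorem run (p q : Point) (c : Chan) (s s' : Sync) (R : State)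
    (h1 : s.maps p (.inp c)) (h2 : s'.maps q (.out c)) :
    Relation.TransGen Step
      (.unmatched p (.inp c) ::ₘ .unmatched q (.out c) ::ₘ .free c ::ₘ
        .opened s ::ₘ .opened s' ::ₘ R)
      (.released (.inp c) ::ₘ .released (.out c) ::ₘ .free c ::ₘ
        .closed s ::ₘ .closed s' ::ₘ R) := by
  have d1 : p ∈ s.dom := Multiset.mem_map_of_mem Prod.fst h1
  have d2 : q ∈ s'.dom := Multiset.mem_map_of_mem Prod.fst h2
  refine .head (.rI p q c _) ?_
  have e1 : Step (.candidate p ::ₘ .candidate q ::ₘ .matched c p q ::ₘ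
      .opened s ::ₘ .opened s' ::ₘ R)
      (.closed s ::ₘ .selected s p ::ₘ .candidate q ::ₘ .matched c p q ::ₘ
        .opened s' ::ₘ R) := by
    have := Step.rIIi p s (.candidate q ::ₘ .matched c p q ::ₘ .opened s' ::ₘ R) d1
    convert this using 1
    simp only [← Multiset.singleton_add]; abel
  refine .head e1 ?_
  have e2 : Step (.closed s ::ₘ .selected s p ::ₘ .candidate q ::ₘ .matched c p q ::ₘ
      .opened s' ::ₘ R)
      (.closed s' ::ₘ .selected s' q ::ₘ .closed s ::ₘ .selected s p ::ₘ
        .matched c p q ::ₘ R) := by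
    have := Step.rIIi q s' (.closed s ::ₘ .selected s p ::ₘ .matched c p q ::ₘ R) d2
    convert this using 1
    simp only [← Multiset.singleton_add]; abel
  refine .head e2 ?_
  have e3 : Step (.closed s' ::ₘ .selected s' q ::ₘ .closed s ::ₘ .selected s p ::ₘ
      .matched c p q ::ₘ R)
      (.done s p ::ₘ .done s' q ::ₘ .free c ::ₘ .closed s ::ₘ .closed s' ::ₘ R) := by
    have := Step.rIIIi s s' p q c (.closed s ::ₘ .closed s' ::ₘ R)
    convert this using 1
    simp only [← Multiset.singleton_add]; abel
  refine .head e3 ?_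
  refine .head (.rIVi s p _ _ h1) ?_
  have e4 := Step.rIVi s' q _ (.released (.inp c) ::ₘ .free c ::ₘ
        .closed s ::ₘ .closed s' ::ₘ R) h2
  rw [Multiset.cons_swap] at e4
  rw [Multiset.cons_swap (SubState.released (.out c)) (SubState.released (.inp c))] at e4
  exact .single e4

theorem exists_pt (s : Sync) (αs : List Act) (h : s.acts = ↑αs) (a : Act) (ha : a ∈ αs) :
    ∃ p t, s.1 = (p, a) ::ₘ t := by
  have : a ∈ s.acts := by rw [h]; simpa using ha
  obtain ⟨⟨p, b⟩, hb, rfl⟩ := Multiset.mem_map.1 this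
  exact ⟨p, Multiset.exists_cons_of_mem hb⟩

/-- **Progress of the compilation** (corollary of the Correctness
theorem): if a program can reduce, its compiled state can make one or
more machine steps matching a program reduction. -/
theorem compilation_progress (P₀ : Program) (σ₀ : State)
    (hc : Compiles P₀ σ₀) (hred : ∃ Q, PStep P₀ Q) :
    ∃ (P' : Program) (σ' : State),
      PStep P₀ P' ∧
      Relation.TransGen Step σ₀ σ' ∧
      State.den σ' = Prog.den P' := by
  obtain ⟨Q, hQ⟩ := hred
  obtain ⟨αs, βs, c, rest, h1, h2⟩ := hQ
  obtain ⟨l, hl, hu, -, rfl⟩ := hc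
  have hs : (l.map fun e => e.2.2).sum
      = ((l : Multiset (Stmt × Sync × Multiset SubState)).map (fun e => e.2.2)).sum := by
    simp
  rw [hs]
  rw [← Multiset.map_coe] at hl
  replace hu : ∀ e ∈ (l : Multiset (Stmt × Sync × Multiset SubState)),
      compUnit e.1 e.2.1 e.2.2 := by simpa using hu
  generalize (l : Multiset (Stmt × Sync × Multiset SubState)) = M at hl hu
  have m1 : Stmt.select αs ∈ M.map (fun e => e.1) := by rw [hl]; simp
  obtain ⟨⟨S1, s1, u1⟩, hm1, hS1⟩ := Multiset.mem_map.1 m1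
  dsimp only at hS1
  subst hS1
  obtain ⟨M, rfl⟩ := Multiset.exists_cons_of_mem hm1
  rw [Multiset.map_cons] at hl
  replace hl := (Multiset.cons_inj_right _).1 hl
  have m2 : Stmt.select βs ∈ M.map (fun e => e.1) := by rw [hl]; simp
  obtain ⟨⟨S2, s2, u2⟩, hm2, hS2⟩ := Multiset.mem_map.1 m2
  dsimp only at hS2
  subst hS2
  obtain ⟨M, rfl⟩ := Multiset.exists_cons_of_mem hm2
  rw [Multiset.map_cons] at hl
  replace hl := (Multiset.cons_inj_right _).1 hl
  obtain ⟨ha1, hu1⟩ := hu _ hm1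
  obtain ⟨ha2, hu2⟩ := hu _ (Multiset.mem_cons_of_mem hm2)
  dsimp only at ha1 hu1 ha2 hu2
  obtain ⟨p, t1, ht1⟩ := exists_pt s1 αs ha1 _ h1
  obtain ⟨q, t2, ht2⟩ := exists_pt s2 βs ha2 _ h2
  have hc : c ∈ (Prog.chans (.select αs ::ₘ .select βs ::ₘ rest)).val := by
    simp only [Prog.chans, Multiset.map_cons, Multiset.sup_cons]
    apply Finset.mem_union_left
    simp only [Stmt.chans, List.mem_toFinset, List.mem_map]
    exact ⟨_, h1, rfl⟩
  obtain ⟨C, hC⟩ := Multiset.exists_cons_of_mem hc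
  rw [hC]
  let f : Point × Act → SubState := fun e => SubState.unmatched e.1 e.2
  refine ⟨_, .released (.inp c) ::ₘ .released (.out c) ::ₘ .free c ::ₘ
    .closed s1 ::ₘ .closed s2 ::ₘ (C.map SubState.free + t1.map f + t2.map f +
      (M.map (fun e => e.2.2)).sum), PStep.comm αs βs c rest h1 h2, ?_, ?_⟩
  · convert run p q c s1 s2 (C.map SubState.free + t1.map f + t2.map f +
      (M.map (fun e => e.2.2)).sum) ?_ ?_ using 1
    · rw [Multiset.map_cons, Multiset.map_cons, Multiset.map_cons, Multiset.sum_cons,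
        Multiset.sum_cons, hu1, hu2, ht1, ht2, Multiset.map_cons, Multiset.map_cons]
      simp only [← Multiset.singleton_add, f]
      abel
    · rw [Sync.maps, ht1]; exact Multiset.mem_cons_self _ _
    · rw [Sync.maps, ht2]; exact Multiset.mem_cons_self _ _
  · simp only [den_cons, den_add, f, den_unm, den_free]
    rw [den_units M (fun e he => hu e (by simp [he])), hl]
    simp [State.den, Prog.den]

end CML
end
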